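/- (Huneke–Srinivasan Multiplicity Conjecture) If M = S/I is a graded Cohen-Macaulay algebra of codimension c over S = K[x_1,...,x_n], then (1/c!) ∏_{i=1}^{c} min{ j : β_{i,j}(M) ≠ 0 } ≤ e(M) ≤ (1/c!) ∏_{i=1}^{c} max{ j : β_{i,j}(M) ≠ 0 }. -/

import Mathlib

open MvPolynomial Finset Module

noncomputable section

/-- The standard graded polynomial ring `S = K[x_1, …, x_n]`. -/
abbrev PolyS (K : Type) [Field K] (n : ℕ) : Type := MvPolynomial (Fin n) K

/-- The `K`-subspace of homogeneous polynomials of integer degree `z`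
(it is `0` if `z < 0`). -/
def homogZ (K : Type) [Field K] (n : ℕ) (z : ℤ) : Submodule K (PolyS K n) :=
  ⨆ (_ : 0 ≤ z), MvPolynomial.homogeneousSubmodule (Fin n) K z.toNat

/-- The degree-`ℓ` piece of the graded free module `⊕ₚ S(-dg p)`. -/
def freePiece {K : Type} [Field K] {n r : ℕ} (dg : Fin r → ℤ) (ℓ : ℤ) :
    Submodule K (Fin r → PolyS K n) :=
  Submodule.pi Set.univ fun p => homogZ K n (ℓ - dg p)

/-- A (homologically indexed) finite complex of graded free `S`-modules
`F₀ ← F₁ ← ⋯ ← F_len ← 0`, where `Fᵢ = ⊕ₚ S(-deg i p)` and the (degree `0`)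
map `Fᵢ₊₁ → Fᵢ` is given by the matrix `dd i`, whose entries are homogeneous
of the appropriate degrees. -/
structure FreeComplex (K : Type) [Field K] (n : ℕ) where
  len : ℕ
  rk : ℕ → ℕ
  deg : (i : ℕ) → Fin (rk i) → ℤ
  dd : (i : ℕ) → Matrix (Fin (rk i)) (Fin (rk (i+1))) (PolyS K n)
  rk_eq_zero : ∀ i, len < i → rk i = 0
  isHomog : ∀ i p q, dd i p q ∈ homogZ K n (deg (i+1) q - deg i p)
  isComplex : ∀ i, dd i * dd (i+1) = 0

variable {K : Type} [Field K] {n : ℕ}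

/-- `F` is exact in positive homological degrees; that is, it is a graded free
resolution of the finitely generated graded module `M = coker (F₁ → F₀)`. -/
def IsResolution (F : FreeComplex K n) : Prop :=
  ∀ i, LinearMap.ker ((F.dd i).mulVecLin) = LinearMap.range ((F.dd (i+1)).mulVecLin)

/-- The complex is minimal: entries of the differentials lie in the maximal ideal,
i.e. all (constant) entries between generators of equal degrees vanish. -/
def IsMinimal (F : FreeComplex K n) : Prop :=
  ∀ i p q, F.deg (i+1) q = F.deg i p → F.dd i p q = 0

/-- Betti number `β_{i,j}`: the number of generators of `Fᵢ` of degree `j`. -/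
def bettiNum (F : FreeComplex K n) (i : ℕ) (j : ℤ) : ℕ :=
  (Finset.univ.filter fun p => F.deg i p = j).card

/-- The dimension of the degree-`ℓ` piece of the module `M = coker (F₁ → F₀)`
resolved by `F`. -/
def MPieceDim (F : FreeComplex K n) (ℓ : ℤ) : ℕ :=
  finrank K ((freePiece (F.deg 0) ℓ) ⧸
    (Submodule.comap (freePiece (F.deg 0) ℓ).subtype
      ((LinearMap.range ((F.dd 0).mulVecLin)).restrictScalars K)))

/-- The Hilbert polynomial of the twisted free module `S(-a)` in `n` variables:
`binom (t - a + n - 1, n - 1)`. -/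
def genHilb (n : ℕ) (a : ℤ) : Polynomial ℚ :=
  if n = 0 then 0 else
    Polynomial.C (((n - 1).factorial : ℚ))⁻¹ *
      ∏ k ∈ Finset.range (n - 1),
        (Polynomial.X - Polynomial.C (a : ℚ) + Polynomial.C ((k : ℚ) + 1))

/-- The Hilbert polynomial of `M = coker (F₁ → F₀)`, computed from the free
resolution `F` by additivity. -/
def hilbPoly (F : FreeComplex K n) : Polynomial ℚ :=
  ∑ i ∈ Finset.range (F.len + 1),
    Polynomial.C ((-1 : ℚ) ^ i) * ∑ p : Fin (F.rk i), genHilb n (F.deg i p)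

/-- The Krull dimension of a module read off from its Hilbert polynomial:
`0` for the zero polynomial (finite length), `deg + 1` otherwise. -/
def polyDim (P : Polynomial ℚ) : ℕ := if P = 0 then 0 else P.natDegree + 1

/-- `M = coker (F₁ → F₀)` is a Cohen-Macaulay module of codimension `c`:
`F` is a minimal free resolution of length exactly `c` (so `pd M = c`, and by
Auslander–Buchsbaum `depth M = n - c`) and `dim M = n - c`. -/
def IsCMcodim (F : FreeComplex K n) (c : ℕ) : Prop :=
  IsResolution F ∧ IsMinimal F ∧ (∀ i, c < i → F.rk i = 0) ∧ F.rk c ≠ 0 ∧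
    polyDim (hilbPoly F) = n - c

/-- The multiplicity `e(M)` of a module of codimension `c`, computed from the
Betti numbers of a free resolution:
`e(M) = ((-1)^c / c!) ⬝ Σ_{i,j} (-1)^i β_{i,j} j^c`. -/
def multQ (F : FreeComplex K n) (c : ℕ) : ℚ :=
  ((-1 : ℚ) ^ c / c.factorial) *
    ∑ i ∈ Finset.range (F.len + 1),
      (-1 : ℚ) ^ i * ∑ p : Fin (F.rk i), ((F.deg i p : ℚ)) ^ c



namespace MC

/-! ### Rank-nullity for exact sequences -/

theorem euler_char {k : Type*} [Field k] (V : ℕ → Type*) [∀ i, AddCommGroup (V i)]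
    [∀ i, Module k (V i)] [∀ i, FiniteDimensional k (V i)]
    (d : ∀ i, V (i+1) →ₗ[k] V i)
    (hex : ∀ i, LinearMap.ker (d i) = LinearMap.range (d (i+1)))
    (len : ℕ) (hlen : ∀ i, len < i → finrank k (V i) = 0) :
    (finrank k (V 0) : ℚ) - finrank k (LinearMap.range (d 0)) =
      ∑ i ∈ Finset.range (len + 1), (-1 : ℚ) ^ i * finrank k (V i) := by
  have h1 : ∀ i, (finrank k (V (i+1)) : ℚ) =
      finrank k (LinearMap.range (d i)) + finrank k (LinearMap.range (d (i+1))) := by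
    intro i
    have := LinearMap.finrank_range_add_finrank_ker (d i)
    rw [hex i] at this
    exact_mod_cast this.symm
  have h2 : ∀ N : ℕ, ∑ i ∈ Finset.range (N + 1), (-1 : ℚ) ^ i * finrank k (V i) =
      (finrank k (V 0) : ℚ) - finrank k (LinearMap.range (d 0)) +
        (-1) ^ N * finrank k (LinearMap.range (d N)) := by
    intro N
    induction N with
    | zero => simp
    | succ N ih =>
      rw [Finset.sum_range_succ, ih, h1 N]
      ring
  rw [h2 len]
  have h3 : finrank k (LinearMap.range (d len)) = 0 := by
    have := LinearMap.finrank_range_le (d len)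
    have h4 := hlen (len+1) (Nat.lt_succ_self _)
    omega
  rw [h3]; simp

/-! ### A double complex chase -/

section chase
variable {k : Type*} [Field k] (D : ℕ → Type*) [∀ i, AddCommGroup (D i)] [∀ i, Module k (D i)]
  (d : ∀ i, D (i+1) →ₗ[k] D i) (δ : ∀ i, D i →ₗ[k] D i) (G : ∀ i, ℕ → Submodule k (D i))

/-- Vanishing of the `δ`-cohomology at position `(i, q)`. -/
def Van (i q : ℕ) : Prop := ∀ x ∈ G i (q+1), δ i x = 0 → ∃ v ∈ G i q, δ i v = x

theorem chase (c : ℕ)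
    (hdd : ∀ i x, d i (d (i+1) x) = 0) (hδδ : ∀ i x, δ i (δ i x) = 0)
    (hcomm : ∀ i x, δ i (d i x) = d i (δ (i+1) x))
    (hGd : ∀ i q x, x ∈ G (i+1) q → d i x ∈ G i q)
    (hGδ : ∀ i q x, x ∈ G i q → δ i x ∈ G i (q+1))
    (hex : ∀ i q x, x ∈ G (i+1) q → d i x = 0 → ∃ y ∈ G (i+2) q, d (i+1) y = x)
    (hlen : ∀ i, c < i → ∀ x : D i, x = 0) :
    ∀ r i q, i + r = c + 1 → (∀ s, Van D δ G (i+1+s) (q+s)) →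
      ∀ z ∈ G (i+1) (q+1), d i (δ (i+1) z) = 0 →
        ∃ w ∈ G (i+2) (q+1), ∃ v ∈ G (i+1) q, z = d (i+1) w + δ (i+1) v := by
  intro r
  induction r with
  | zero =>
    intro i q hi _ z _ _
    exact ⟨0, zero_mem _, 0, zero_mem _, by rw [hlen (i+1) (by omega) z]; simp⟩
  | succ r ih =>
    intro i q hi hV z hz hdz
    obtain ⟨z', hz', hzz'⟩ := hex i (q+2) (δ (i+1) z) (hGδ _ _ _ hz) hdz
    obtain ⟨w', hw', v', hv', h'⟩ := ih (i+1) (q+1) (by omega)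
      (fun s => by
        have := hV (s+1)
        have e1 : i + 1 + (s+1) = i+1+1+s := by ring
        have e2 : q + (s+1) = q+1+s := by ring
        rw [e1, e2] at this; exact this) z' hz'
      (by rw [← hcomm, hzz', hδδ])
    have h3 : δ (i+1) (z - d (i+1) v') = 0 := by
      rw [map_sub, hcomm, ← hzz', h', map_add, hdd, zero_add, sub_self]
    obtain ⟨v, hv, hvz⟩ := hV 0 (z - d (i+1) v') (Submodule.sub_mem _ hz (hGd _ _ _ hv')) h3
    refine ⟨v', hv', v, hv, ?_⟩
    have h4 : δ (i+1) v = z - d (i+1) v' := hvz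
    rw [h4]; abel

theorem chase_upper (c : ℕ)
    (hdd : ∀ i x, d i (d (i+1) x) = 0) (hδδ : ∀ i x, δ i (δ i x) = 0)
    (hcomm : ∀ i x, δ i (d i x) = d i (δ (i+1) x))
    (hGd : ∀ i q x, x ∈ G (i+1) q → d i x ∈ G i q)
    (hGδ : ∀ i q x, x ∈ G i q → δ i x ∈ G i (q+1))
    (hex : ∀ i q x, x ∈ G (i+1) q → d i x = 0 → ∃ y ∈ G (i+2) q, d (i+1) y = x)
    (hlen : ∀ i, c < i → ∀ x : D i, x = 0)
    (i : ℕ) (hV : ∀ s, Van D δ G (i+1+s) (1+s)) (x : D i)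
    (hy : ∃ y ∈ G (i+1) 2, d i y = δ i x) :
    ∃ v ∈ G (i+1) 1, δ i (x - d i v) = 0 := by
  obtain ⟨y, hy, hyx⟩ := hy
  rcases Nat.lt_or_ge (c+1) i with hi | hi
  · exact ⟨0, zero_mem _, by rw [hlen i (by omega) x]; simp⟩
  obtain ⟨w, hw, v, hv, h⟩ := chase D d δ G c hdd hδδ hcomm hGd hGδ hex hlen (c+1-i) i 1 (by omega)
    hV y hy (by rw [← hcomm, hyx, hδδ])
  refine ⟨v, hv, ?_⟩
  rw [map_sub, hcomm, ← hyx, h, map_add, hdd, zero_add, sub_self]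

theorem chase_lower (c : ℕ)
    (hdd : ∀ i x, d i (d (i+1) x) = 0) (hδδ : ∀ i x, δ i (δ i x) = 0)
    (hcomm : ∀ i x, δ i (d i x) = d i (δ (i+1) x))
    (hGd : ∀ i q x, x ∈ G (i+1) q → d i x ∈ G i q)
    (hGδ : ∀ i q x, x ∈ G i q → δ i x ∈ G i (q+1))
    (hex : ∀ i q x, x ∈ G (i+1) q → d i x = 0 → ∃ y ∈ G (i+2) q, d (i+1) y = x)
    (hlen : ∀ i, c < i → ∀ x : D i, x = 0) (hG0 : ∀ i, G i 0 = ⊥)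
    (hV : ∀ s, Van D δ G (1+s) s) (z : D 1) (hz : z ∈ G 1 1) (h : δ 0 (d 0 z) = 0) :
    d 0 z = 0 := by
  obtain ⟨w, hw, v, hv, h⟩ := chase D d δ G c hdd hδδ hcomm hGd hGδ hex hlen (c+1) 0 0 (by omega)
    (fun s => by simpa using hV s) z hz (by rw [← hcomm, h])
  rw [hG0, Submodule.mem_bot] at hv
  rw [h, hv, map_zero, add_zero, hdd]

end chase

/-! ### The cube complex -/

section cube
variable {k : Type*} [CommRing k] {V : Type*} [AddCommGroup V] [Module k V] {c : ℕ}

/-- sign -/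
def sg (l : Fin c) (A : Finset (Fin c)) : ℤ := (-1) ^ (A.filter (· < l)).card

theorem sg_sq (l : Fin c) (A : Finset (Fin c)) : sg l A * sg l A = 1 := by
  unfold sg; rw [← mul_pow]; simp

theorem sg_erase_self (l : Fin c) (A : Finset (Fin c)) : sg l (A.erase l) = sg l A := by
  unfold sg
  congr 2
  ext x; simp only [mem_filter, mem_erase]
  constructor
  · rintro ⟨⟨_, h⟩, h2⟩; exact ⟨h, h2⟩
  · rintro ⟨h, h2⟩; exact ⟨⟨h2.ne, h⟩, h2⟩

theorem sg_insert_self (l : Fin c) (A : Finset (Fin c)) : sg l (insert l A) = sg l A := by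
  unfold sg
  congr 2
  rw [Finset.filter_insert, if_neg (lt_irrefl _)]

theorem sg_insert_lt {j l : Fin c} {A : Finset (Fin c)} (h : j < l) (hj : j ∉ A) :
    sg l (insert j A) = - sg l A := by
  unfold sg
  rw [Finset.filter_insert, if_pos h, Finset.card_insert_of_notMem (by simp [hj]), pow_succ]
  ring

theorem sg_insert_gt {j l : Fin c} {A : Finset (Fin c)} (h : l < j) :
    sg l (insert j A) = sg l A := by
  unfold sg
  rw [Finset.filter_insert, if_neg (not_lt.mpr h.le)]

/-- the basic sign rule -/
theorem sg_rule {j l : Fin c} {A : Finset (Fin c)} (hj : j ∉ A) (hl : l ∉ A) (hjl : j ≠ l) :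
    sg l (insert j A) * sg j A = - (sg j (insert l A) * sg l A) := by
  rcases lt_or_gt_of_ne hjl with h | h
  · rw [sg_insert_lt h hj, sg_insert_gt h]; ring
  · rw [sg_insert_gt h, sg_insert_lt h hl]; ring

/-- the differential of the cube complex -/
def cubeδ (ι : Fin c → V →ₗ[k] V) : (Finset (Fin c) → V) →ₗ[k] (Finset (Fin c) → V) :=
  LinearMap.pi fun A => ∑ l ∈ A, sg l A • (ι l ∘ₗ LinearMap.proj (A.erase l))

theorem cubeδ_apply (ι : Fin c → V →ₗ[k] V) (x : Finset (Fin c) → V) (A : Finset (Fin c)) :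
    cubeδ ι x A = ∑ l ∈ A, sg l A • ι l (x (A.erase l)) := by
  simp [cubeδ, LinearMap.sum_apply]

theorem cubeδ_sq (ι : Fin c → V →ₗ[k] V) (hι : ∀ j l, j ≠ l → ∀ v, ι j (ι l v) = ι l (ι j v))
    (x : Finset (Fin c) → V) : cubeδ ι (cubeδ ι x) = 0 := by
  funext A
  rw [cubeδ_apply]
  simp_rw [cubeδ_apply, map_sum, Finset.smul_sum]
  rw [Finset.sum_sigma']
  refine Finset.sum_involution (fun a _ => ⟨a.2, a.1⟩) ?_ ?_ ?_ ?_
  · rintro ⟨j, l⟩ h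
    simp only [mem_sigma, mem_erase] at h
    obtain ⟨hj, hlj, hl⟩ := h
    simp only
    have e : (A.erase l).erase j = (A.erase j).erase l := Finset.erase_right_comm
    rw [e, map_zsmul, map_zsmul, smul_smul, smul_smul, hι l j hlj]
    rw [← add_smul]
    have h1 : A = insert j (insert l ((A.erase j).erase l)) := by
      rw [Finset.insert_erase (by simp [hl, hlj]), Finset.insert_erase hj]
    have hs := sg_rule (j := j) (l := l) (A := (A.erase j).erase l) (by simp) (by simp) hlj.symm
    have e1 : insert l ((A.erase j).erase l) = A.erase j := Finset.insert_erase (by simp [hl, hlj])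
    have e2 : insert j ((A.erase j).erase l) = A.erase l := by
      rw [← e]; exact Finset.insert_erase (by simp [hj, hlj.symm])
    rw [e1, e2, ← e] at hs
    rw [sg_erase_self, sg_erase_self, e, sg_erase_self, sg_erase_self] at hs
    have : sg j A * sg l (A.erase j) + sg l A * sg j (A.erase l) = 0 := by
      rw [mul_comm] at hs; rw [mul_comm (sg l A), mul_comm (sg j A)]; linarith
    rw [this, zero_smul]
  · rintro ⟨j, l⟩ h _ h3
    simp only [mem_sigma, mem_erase] at h
    simp only [Sigma.mk.injEq] at h3
    exact h.2.1 h3.1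
  · rintro ⟨j, l⟩ h
    simp only [mem_sigma, mem_erase] at h ⊢
    exact ⟨h.2.2, h.2.1.symm, h.1⟩
  · rintro ⟨j, l⟩ h; rfl

/-- the contracting homotopy in direction `j`. -/
def cubeh (σ : Fin c → V →ₗ[k] V) (j : Fin c) (x : Finset (Fin c) → V) : Finset (Fin c) → V :=
  fun A => if j ∈ A then 0 else sg j A • σ j (x (insert j A))

theorem cube_homotopy (ι σ : Fin c → V →ₗ[k] V)
    (hισ : ∀ j l, j ≠ l → ∀ v, ι j (σ l v) = σ l (ι j v)) (j : Fin c)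
    (x : Finset (Fin c) → V) (hx : cubeδ ι x = 0) (A : Finset (Fin c)) :
    cubeδ ι (cubeh σ j x) A = if j ∈ A then ι j (σ j (x A)) else σ j (ι j (x A)) := by
  by_cases hj : j ∈ A
  · rw [if_pos hj, cubeδ_apply, Finset.sum_eq_single j]
    · simp only [cubeh]
      rw [if_neg (by simp), map_zsmul, smul_smul, sg_erase_self, sg_sq, one_smul,
        Finset.insert_erase hj]
    · intro l hl hlj
      simp only [cubeh]
      rw [if_pos (by simp [hj, hlj.symm]), map_zero, smul_zero]
    · intro h; exact absurd hj h
  · rw [if_neg hj]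
    have h0 : cubeδ ι x (insert j A) = 0 := by rw [hx]; rfl
    rw [cubeδ_apply, Finset.sum_insert hj, Finset.erase_insert hj, sg_insert_self] at h0
    have h1 : ι j (x A) = - (sg j A • ∑ l ∈ A, sg l (insert j A) • ι l (x ((insert j A).erase l))) := by
      have := congrArg (fun v => sg j A • v) h0
      simp only [smul_add, smul_smul, sg_sq, one_smul, smul_zero] at this
      exact eq_neg_of_add_eq_zero_left this
    rw [h1, map_neg, map_zsmul, map_sum, cubeδ_apply, Finset.smul_sum, ← Finset.sum_neg_distrib]
    refine Finset.sum_congr rfl fun l hl => ?_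
    have hlj : l ≠ j := fun h => hj (h ▸ hl)
    simp only [cubeh]
    have e : (insert j A).erase l = insert j (A.erase l) := Finset.erase_insert_of_ne hlj.symm
    rw [if_neg (by simp [hj]), map_zsmul, smul_smul, map_zsmul, smul_smul, hισ l j hlj, e, ← neg_smul]
    congr 1
    have hs := sg_rule (j := j) (l := l) (A := A.erase l) (by simp [hj]) (by simp) hlj.symm
    rw [Finset.insert_erase hl, sg_erase_self, ← e, sg_erase_self] at hs
    have q1 := sg_sq j A
    have q2 := sg_sq j (A.erase l)
    have q3 := sg_sq l A
    have q4 := sg_sq l (insert j A)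
    -- a*b = -(c*d)
    have : sg l A * sg j (A.erase l) = - (sg j A * sg l (insert j A)) := by
      have h5 : (sg l A * sg j (A.erase l)) = (sg l A * sg j (A.erase l)) *
        ((sg l (insert j A) * sg l (insert j A)) * (sg j A * sg j A)) := by rw [q1, q4]; ring
      have h6 : (sg l (insert j A) * sg j (A.erase l)) * (sg l (insert j A) * sg j (A.erase l)) = 1 := by
        calc _ = (sg l (insert j A) * sg l (insert j A)) * (sg j (A.erase l) * sg j (A.erase l)) := by ring
          _ = 1 := by rw [q4, q2]; ring
      calc (sg l A * sg j (A.erase l)) = (sg j A * sg l A) * (sg l (insert j A) * sg j (A.erase l)) *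
            (sg j A * sg l (insert j A)) := by rw [h5]; ring
        _ = - ((sg l (insert j A) * sg j (A.erase l)) * (sg l (insert j A) * sg j (A.erase l))) *
            (sg j A * sg l (insert j A)) := by
              have : sg j A * sg l A = -(sg l (insert j A) * sg j (A.erase l)) := by linarith
              rw [this]; ring
        _ = _ := by rw [h6]; ring
    exact this

theorem cube_van (ι σ : Fin c → V →ₗ[k] V)
    (hι : ∀ j l, j ≠ l → ∀ v, ι j (ι l v) = ι l (ι j v))
    (hισ : ∀ j l, j ≠ l → ∀ v, ι j (σ l v) = σ l (ι j v))
    (q : ℕ)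
    (hq : ∀ A : Finset (Fin c), A.card = q →
      (∃ j ∈ A, ∀ v, ι j (σ j v) = v) ∨ (∃ j, j ∉ A ∧ ∀ v, σ j (ι j v) = v))
    (x : Finset (Fin c) → V) (hx : ∀ A, A.card ≠ q → x A = 0) (hδ : cubeδ ι x = 0) :
    ∃ v : Finset (Fin c) → V, (∀ A, A.card + 1 ≠ q → v A = 0) ∧ cubeδ ι v = x := by
  have key : ∀ s : Finset (Fin c), ∃ v : Finset (Fin c) → V, (∀ A, A.card + 1 ≠ q → v A = 0) ∧
      (∀ A, A.card ≠ q → (x - cubeδ ι v) A = 0) ∧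
      ∀ A, (x - cubeδ ι v) A ≠ 0 → ∀ j ∈ s,
        (j ∈ A → ¬ ∀ v, ι j (σ j v) = v) ∧ (j ∉ A → ¬ ∀ v, σ j (ι j v) = v) := by
    intro s
    induction s using Finset.induction_on with
    | empty =>
      refine ⟨0, by simp, ?_, by simp⟩
      intro A hA; simp [hx A hA]
    | insert j s hj ih =>
      obtain ⟨v, hv1, hv2, hv3⟩ := ih
      set y := x - cubeδ ι v with hy
      have hyδ : cubeδ ι y = 0 := by rw [hy, map_sub, hδ, cubeδ_sq ι hι, sub_zero]
      have e : ∀ A, (x - cubeδ ι (v + cubeh σ j y)) A =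
          y A - if j ∈ A then ι j (σ j (y A)) else σ j (ι j (y A)) := by
        intro A
        rw [map_add, ← sub_sub, ← hy, Pi.sub_apply, cube_homotopy ι σ hισ j y hyδ A]
      refine ⟨v + cubeh σ j y, ?_, ?_, ?_⟩
      · intro A hA
        rw [Pi.add_apply, hv1 A hA, zero_add]
        unfold cubeh
        split_ifs with h
        · rfl
        · rw [hv2 _ (by rw [Finset.card_insert_of_notMem h]; exact hA)]; simp
      · intro A hA
        rw [e A, hv2 A hA]; simp
      · intro A hA l hl
        rw [e A] at hA
        have hy0 : y A ≠ 0 := by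
          intro h; apply hA; rw [h]; simp
        rcases Finset.mem_insert.mp hl with rfl | hl
        · constructor
          · intro h1 h2; apply hA; rw [if_pos h1, h2, sub_self]
          · intro h1 h2; apply hA; rw [if_neg h1, h2, sub_self]
        · exact hv3 A hy0 l hl
  obtain ⟨v, hv1, hv2, hv3⟩ := key Finset.univ
  refine ⟨v, hv1, ?_⟩
  have : x - cubeδ ι v = 0 := by
    funext A
    by_contra h
    have hA : A.card = q := by
      by_contra h'; exact h (hv2 A h')
    rcases hq A hA with ⟨j, hj, hj2⟩ | ⟨j, hj, hj2⟩
    · exact (hv3 A h j (Finset.mem_univ _)).1 hj hj2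
    · exact (hv3 A h j (Finset.mem_univ _)).2 hj hj2
  exact (sub_eq_zero.mp this).symm

end cube
end MC

namespace MC
section shifts
variable {k : Type} [Field k] {c : ℕ}

/-- replace the exponent of the `l`-th variable. -/
def upd (m : Fin c →₀ ℕ) (l : Fin c) (a : ℕ) : Fin c →₀ ℕ :=
  Finsupp.equivFunOnFinite.symm (Function.update m l a)

@[simp] theorem upd_same (m : Fin c →₀ ℕ) (l : Fin c) (a : ℕ) : upd m l a l = a := by
  simp [upd]

theorem upd_ne (m : Fin c →₀ ℕ) {l j : Fin c} (h : j ≠ l) (a : ℕ) : upd m l a j = m j := by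
  simp [upd, h]

theorem upd_upd (m : Fin c →₀ ℕ) (l : Fin c) (a b : ℕ) : upd (upd m l a) l b = upd m l b := by
  ext j; by_cases h : j = l
  · subst h; simp
  · simp [upd_ne _ h]

theorem upd_self (m : Fin c →₀ ℕ) (l : Fin c) : upd m l (m l) = m := by
  ext j; by_cases h : j = l
  · subst h; simp
  · simp [upd_ne _ h]

theorem upd_comm (m : Fin c →₀ ℕ) {l j : Fin c} (h : j ≠ l) (a b : ℕ) :
    upd (upd m l a) j b = upd (upd m j b) l a := by
  ext i; by_cases h1 : i = l
  · subst h1; rw [upd_ne _ h.symm]; simp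
  · by_cases h2 : i = j
    · subst h2; rw [upd_ne (upd m i b) h1]; simp
    · rw [upd_ne _ h2, upd_ne _ h1, upd_ne _ h1, upd_ne _ h2]

/-- truncated shift by `s` of the exponent of the `l`-th variable. -/
def sh (l : Fin c) (s : ℤ) : MvPolynomial (Fin c) k →ₗ[k] MvPolynomial (Fin c) k :=
  (basisMonomials (Fin c) k).constr k fun m =>
    if 0 ≤ (m l : ℤ) + s then monomial (upd m l ((m l : ℤ) + s).toNat) 1 else 0

theorem sh_monomial (l : Fin c) (s : ℤ) (m : Fin c →₀ ℕ) (a : k) :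
    sh l s (monomial m a) =
      if 0 ≤ (m l : ℤ) + s then monomial (upd m l ((m l : ℤ) + s).toNat) a else 0 := by
  have h : (monomial m a : MvPolynomial (Fin c) k) = a • (basisMonomials (Fin c) k m) := by
    simp [coe_basisMonomials, smul_monomial]
  rw [h, map_smul, sh, Basis.constr_basis]
  split_ifs <;> simp [smul_monomial]

theorem coeff_sh (l : Fin c) (s : ℤ) (v : MvPolynomial (Fin c) k) (m : Fin c →₀ ℕ) :
    coeff m (sh l s v) =
      if 0 ≤ (m l : ℤ) - s then coeff (upd m l ((m l : ℤ) - s).toNat) v else 0 := by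
  induction v using MvPolynomial.induction_on' with
  | monomial u a =>
    rw [sh_monomial]
    split_ifs with h1 h2 h2
    · rw [coeff_monomial, coeff_monomial]
      congr 1
      apply propext
      constructor
      · rintro rfl; rw [upd_upd]; simp only [upd_same]
        rw [Int.toNat_of_nonneg h1]; simp [upd_self]
      · rintro rfl; rw [upd_upd]; simp only [upd_same]
        rw [Int.toNat_of_nonneg h2]; simp [upd_self]
    · rw [coeff_monomial, if_neg]
      rintro rfl
      apply h2; simp only [upd_same]; rw [Int.toNat_of_nonneg h1]; simp
    · rw [coeff_monomial, if_neg, coeff_zero]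
      rintro rfl
      apply h1; simp only [upd_same]; rw [Int.toNat_of_nonneg h2]; simp
    · simp
  | add p q hp hq =>
    rw [map_add, coeff_add, hp, hq]
    split_ifs <;> simp

theorem sh_comm {l j : Fin c} (h : j ≠ l) (s s' : ℤ) (v : MvPolynomial (Fin c) k) :
    sh j s (sh l s' v) = sh l s' (sh j s v) := by
  ext m
  simp only [coeff_sh, upd_ne _ h.symm, upd_ne _ h]
  rw [upd_comm _ h]
  split_ifs <;> rfl

theorem sh_sh (l : Fin c) (s s' : ℤ) (h : s ≤ 0 ∨ 0 ≤ s') (v : MvPolynomial (Fin c) k) :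
    sh l s (sh l s' v) = sh l (s + s') v := by
  ext m
  simp only [coeff_sh, upd_same, upd_upd]
  have e : ∀ _ : 0 ≤ (m l : ℤ) - s,
    ((((m l : ℤ) - s).toNat : ℕ) : ℤ) - s' = (m l : ℤ) - (s + s') := by
    intro h; rw [Int.toNat_of_nonneg h]; ring
  by_cases h1 : 0 ≤ (m l : ℤ) - s
  · rw [if_pos h1, e h1]
  · rw [if_neg h1, if_neg]; omega

theorem sh_zero (l : Fin c) (v : MvPolynomial (Fin c) k) : sh l 0 v = v := by
  ext m; simp [coeff_sh, upd_self]

theorem sh_one (l : Fin c) (v : MvPolynomial (Fin c) k) : sh l 1 v = X l * v := by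
  induction v using MvPolynomial.induction_on' with
  | monomial u a =>
    rw [sh_monomial, if_pos (by positivity), X, monomial_mul, one_mul]
    congr 1
    congr 1
    ext j
    by_cases h : j = l
    · subst h; rw [upd_same]; simp; omega
    · rw [upd_ne _ h]; simp [Finsupp.single_apply, Ne.symm h]
  | add p q hp hq => rw [map_add, hp, hq, mul_add]

theorem sh_eq_zero (l : Fin c) (s : ℤ) (hs : 0 ≤ s) (v : MvPolynomial (Fin c) k) :
    sh l (-s) v = 0 ↔ ∀ m ∈ v.support, (m l : ℤ) < s := by
  constructor
  · intro h m hm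
    by_contra h2
    push Not at h2
    have := congrArg (coeff (upd m l ((m l : ℤ) - s).toNat)) h
    rw [coeff_sh, upd_same, upd_upd, Int.toNat_of_nonneg (by omega)] at this
    rw [if_pos (by omega)] at this
    have e : ((m l : ℤ) - s - -s).toNat = m l := by omega
    rw [e, upd_self] at this
    rw [MvPolynomial.mem_support_iff] at hm
    exact hm (by simpa using this)
  · intro h
    ext m
    rw [coeff_sh, coeff_zero]
    split_ifs with h1
    · by_contra h2
      have := h _ (MvPolynomial.mem_support_iff.mpr h2)
      rw [upd_same, Int.toNat_of_nonneg h1] at this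
      omega
    · rfl

/-- The box of polynomials with exponents `< B l`, as the kernel of shifts. -/
def Box (B : Fin c → ℤ) : Submodule k (MvPolynomial (Fin c) k) :=
  ⨅ l, LinearMap.ker (sh l (-(B l)))

theorem mem_Box (B : Fin c → ℤ) (v : MvPolynomial (Fin c) k) :
    v ∈ Box B ↔ ∀ l, sh l (-(B l)) v = 0 := by
  simp [Box]

theorem Box_eq (B : Fin c → ℕ) : (Box (fun l => (B l : ℤ)) : Submodule k (MvPolynomial (Fin c) k)) =
    restrictSupport k {m : Fin c →₀ ℕ | ∀ l, m l < B l} := by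
  ext v
  rw [mem_Box, mem_restrictSupport_iff]
  constructor
  · intro h m hm l
    have := (sh_eq_zero l (B l) (by positivity) v).mp (h l) m hm
    exact_mod_cast this
  · intro h l
    rw [sh_eq_zero l _ (by positivity)]
    intro m hm
    have := h hm l
    exact_mod_cast this

/-- exponents in a box -/
def boxEquiv (B : Fin c → ℕ) : {m : Fin c →₀ ℕ | ∀ l, m l < B l} ≃ (∀ l, Fin (B l)) where
  toFun m l := ⟨m.1 l, m.2 l⟩
  invFun f := ⟨Finsupp.equivFunOnFinite.symm fun l => f l, fun l => by simp⟩
  left_inv m := by ext; simp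
  right_inv f := by ext; simp

theorem finrank_Box (B : Fin c → ℕ) :
    finrank k (Box (fun l => (B l : ℤ)) : Submodule k (MvPolynomial (Fin c) k)) = ∏ l, B l := by
  rw [Box_eq, Module.finrank_eq_nat_card_basis (basisRestrictSupport k _),
    Nat.card_congr (boxEquiv B)]
  simp

theorem finite_Box (B : Fin c → ℕ) :
    FiniteDimensional k (Box (fun l => (B l : ℤ)) : Submodule k (MvPolynomial (Fin c) k)) := by
  rw [Box_eq]
  haveI : Finite {m : Fin c →₀ ℕ | ∀ l, m l < B l} := Finite.of_equiv _ (boxEquiv B).symm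
  exact Module.Finite.of_basis (basisRestrictSupport k {m : Fin c →₀ ℕ | ∀ l, m l < B l})

/-- the operator by which the `l`-th variable acts on the `A`-th module. -/
def xop (A : Finset (Fin c)) (l : Fin c) : Module.End k (MvPolynomial (Fin c) k) :=
  if l ∈ A then sh l (-1) else sh l 1

theorem xop_comm (A : Finset (Fin c)) (j l : Fin c) : xop (k := k) A j * xop A l = xop A l * xop A j := by
  by_cases h : j = l
  · rw [h]
  · refine LinearMap.ext fun v => ?_
    simp only [xop, Module.End.mul_apply]
    split_ifs <;> exact sh_comm h _ _ v

theorem xop_comm' (A : Finset (Fin c)) :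
    ∀ a ∈ Set.range (xop (k := k) A), ∀ b ∈ Set.range (xop (k := k) A), a * b = b * a := by
  rintro _ ⟨j, rfl⟩ _ ⟨l, rfl⟩; exact xop_comm A j l

/-- the action -/
def rho (A : Finset (Fin c)) : MvPolynomial (Fin c) k →ₐ[k] Module.End k (MvPolynomial (Fin c) k) :=
  letI := Algebra.adjoinCommRingOfComm k (xop_comm' (k := k) A)
  (Subalgebra.val (Algebra.adjoin k (Set.range (xop (k := k) A)))).comp
    (MvPolynomial.aeval fun l =>
      (⟨xop A l, Algebra.subset_adjoin ⟨l, rfl⟩⟩ : Algebra.adjoin k (Set.range (xop (k := k) A))))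

theorem rho_X (A : Finset (Fin c)) (l : Fin c) : rho (k := k) A (X l) = xop A l := by
  simp [rho]

theorem rho_C (A : Finset (Fin c)) (a : k) (v : MvPolynomial (Fin c) k) : rho A (C a) v = a • v := by
  have : rho (k := k) A (C a) = algebraMap k _ a := AlgHom.commutes (rho (k := k) A) a
  rw [this]; rfl

/-- the `A`-th module -/
def VA (k : Type) [Field k] (c : ℕ) (_A : Finset (Fin c)) : Type := MvPolynomial (Fin c) k

instance (A : Finset (Fin c)) : AddCommGroup (VA k c A) :=
  inferInstanceAs (AddCommGroup (MvPolynomial (Fin c) k))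
instance (A : Finset (Fin c)) : Module k (VA k c A) :=
  inferInstanceAs (Module k (MvPolynomial (Fin c) k))
instance (A : Finset (Fin c)) : Module (MvPolynomial (Fin c) k) (VA k c A) :=
  Module.compHom (MvPolynomial (Fin c) k) (rho (k := k) A).toRingHom

theorem smul_VA (A : Finset (Fin c)) (f : MvPolynomial (Fin c) k) (v : VA k c A) :
    f • v = (rho A f v : MvPolynomial (Fin c) k) := rfl

end shifts
end MC

namespace MC
section acyc
variable {R : Type} [CommRing R] {V : Type} [AddCommGroup V] [Module R V]

/-- a matrix over `R` acting on columns with entries in an `R`-module. -/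
def act (V : Type) [AddCommGroup V] [Module R V] {a b : ℕ} (M : Matrix (Fin a) (Fin b) R) :
    (Fin b → V) →ₗ[R] (Fin a → V) :=
  LinearMap.pi fun p => ∑ q, M p q • LinearMap.proj q

theorem act_apply {a b : ℕ} (M : Matrix (Fin a) (Fin b) R) (v : Fin b → V) (p : Fin a) :
    act V M v p = ∑ q, M p q • v q := by
  simp [act, LinearMap.sum_apply]

theorem act_mul {a b e : ℕ} (M : Matrix (Fin a) (Fin b) R) (M' : Matrix (Fin b) (Fin e) R)
    (v : Fin e → V) : act V (M * M') v = act V M (act V M' v) := by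
  funext p
  simp only [act_apply, Matrix.mul_apply, Finset.sum_smul, Finset.smul_sum, mul_smul]
  rw [Finset.sum_comm]

theorem act_add {a b : ℕ} (M M' : Matrix (Fin a) (Fin b) R) (v : Fin b → V) :
    act V (M + M') v = act V M v + act V M' v := by
  funext p
  simp [act_apply, add_smul, Finset.sum_add_distrib]

theorem act_zero {a b : ℕ} (v : Fin b → V) : act V (0 : Matrix (Fin a) (Fin b) R) v = 0 := by
  funext p
  simp [act_apply]

theorem act_smul_one {a : ℕ} (y : R) (v : Fin a → V) :
    act V (y • (1 : Matrix (Fin a) (Fin a) R)) v = y • v := by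
  funext p
  simp [act_apply, Matrix.one_apply, ite_smul]

/-- tuples with entries in `N` -/
def tup (N : Submodule R V) (a : ℕ) : Submodule R (Fin a → V) := Submodule.pi Set.univ fun _ => N

theorem mem_tup {N : Submodule R V} {a : ℕ} {v : Fin a → V} : v ∈ tup N a ↔ ∀ p, v p ∈ N := by
  simp [tup]

theorem act_mem_tup {N : Submodule R V} {a b : ℕ} (M : Matrix (Fin a) (Fin b) R) {v : Fin b → V}
    (hv : v ∈ tup N b) : act V M v ∈ tup N a := by
  rw [mem_tup] at *
  intro p
  rw [act_apply]
  exact Submodule.sum_mem _ fun q _ => Submodule.smul_mem _ _ (hv q)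

/-- exactness modulo `N` -/
def Ex {a b e : ℕ} (f : Matrix (Fin b) (Fin a) R) (g : Matrix (Fin e) (Fin b) R)
    (N : Submodule R V) : Prop :=
  ∀ x : Fin b → V, act V g x ∈ tup N e → ∃ y : Fin a → V, x - act V f y ∈ tup N b

/-- the image of multiplication -/
def rng (V : Type) [AddCommGroup V] [Module R V] (y : R) : Submodule R V :=
  LinearMap.range (LinearMap.lsmul R V y)

theorem mem_tup_sup {N : Submodule R V} {y : R} {a : ℕ} {v : Fin a → V} :
    v ∈ tup (N ⊔ rng V y) a ↔ ∃ n ∈ tup N a, ∃ w : Fin a → V, v = n + y • w := by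
  rw [mem_tup]
  constructor
  · intro h
    have h2 : ∀ p, ∃ n ∈ N, ∃ w : V, v p = n + y • w := by
      intro p
      obtain ⟨n, hn, z, ⟨w, rfl⟩, e⟩ := Submodule.mem_sup.mp (h p)
      exact ⟨n, hn, w, e.symm⟩
    choose n hn w hw using h2
    exact ⟨n, mem_tup.mpr hn, w, funext hw⟩
  · rintro ⟨n, hn, w, rfl⟩ p
    exact Submodule.mem_sup.mpr ⟨n p, mem_tup.mp hn p, y • w p, ⟨w p, rfl⟩, rfl⟩

/-- from exactness modulo `N` to exactness modulo `N + y V` (used for the Hilbert syzygy theorem) -/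
theorem Ex_down {a b e z : ℕ} (f : Matrix (Fin b) (Fin a) R) (g : Matrix (Fin e) (Fin b) R)
    (h : Matrix (Fin z) (Fin e) R) (hgh : h * g = 0) (N : Submodule R V) (y : R)
    (hy : ∀ v : V, y • v ∈ N → v ∈ N) (h1 : Ex f g N) (h2 : Ex g h N) :
    Ex f g (N ⊔ rng V y) := by
  intro x hx
  obtain ⟨m, hm, w, hw⟩ := mem_tup_sup.mp hx
  have h3 : act V h w ∈ tup N z := by
    rw [mem_tup]
    intro p
    apply hy
    have : act V h (act V g x) = 0 := by rw [← act_mul, hgh, act_zero]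
    rw [hw, map_add, map_smul] at this
    have h4 := congrFun this p
    have h5 : y • act V h w p = - act V h m p := by
      simp only [Pi.add_apply, Pi.smul_apply, Pi.zero_apply] at h4
      rw [eq_neg_iff_add_eq_zero, add_comm]; exact h4
    rw [h5]
    exact Submodule.neg_mem _ (mem_tup.mp (act_mem_tup h hm) p)
  obtain ⟨b', hb⟩ := h2 w h3
  have h6 : act V g (x - y • b') ∈ tup N e := by
    rw [map_sub, map_smul, hw]
    have : m + y • w - y • act V g b' = m + y • (w - act V g b') := by rw [smul_sub]; abel
    rw [this]
    exact Submodule.add_mem _ hm (Submodule.smul_mem _ _ hb)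
  obtain ⟨u, hu⟩ := h1 _ h6
  refine ⟨u, mem_tup_sup.mpr ⟨_, hu, b', ?_⟩⟩
  abel

/-- `y` acts injectively on homology modulo `N`. -/
def InjH {a b e : ℕ} (f : Matrix (Fin b) (Fin a) R) (g : Matrix (Fin e) (Fin b) R)
    (N : Submodule R V) (y : R) : Prop :=
  ∀ x : Fin b → V, act V g x ∈ tup N e → (∃ w : Fin a → V, y • x - act V f w ∈ tup N b) →
    ∃ w : Fin a → V, x - act V f w ∈ tup N b

theorem InjH.mul {a b e : ℕ} {f : Matrix (Fin b) (Fin a) R} {g : Matrix (Fin e) (Fin b) R}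
    {N : Submodule R V} {y y' : R} (h : InjH f g N y) (h' : InjH f g N y') :
    InjH f g N (y * y') := by
  rintro x hx ⟨w, hw⟩
  apply h' x hx
  apply h (y' • x)
  · rw [map_smul]; exact Submodule.smul_mem _ _ hx
  · refine ⟨w, ?_⟩
    rwa [smul_smul]

theorem InjH.one {a b e : ℕ} {f : Matrix (Fin b) (Fin a) R} {g : Matrix (Fin e) (Fin b) R}
    {N : Submodule R V} : InjH f g N 1 := by
  rintro x hx ⟨w, hw⟩
  exact ⟨w, by simpa using hw⟩

theorem InjH.pow {a b e : ℕ} {f : Matrix (Fin b) (Fin a) R} {g : Matrix (Fin e) (Fin b) R}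
    {N : Submodule R V} {y : R} (h : InjH f g N y) (r : ℕ) : InjH f g N (y ^ r) := by
  induction r with
  | zero => rw [pow_zero]; exact InjH.one
  | succ r ih => rw [pow_succ]; exact ih.mul h

theorem InjH.prod {a b e : ℕ} {f : Matrix (Fin b) (Fin a) R} {g : Matrix (Fin e) (Fin b) R}
    {N : Submodule R V} {κ : Type} (s : Finset κ) (y : κ → R) (h : ∀ j ∈ s, InjH f g N (y j)) :
    InjH f g N (∏ j ∈ s, y j) := by
  classical
  induction s using Finset.induction_on with
  | empty => rw [Finset.prod_empty]; exact InjH.one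
  | insert j s hj ih =>
    rw [Finset.prod_insert hj]
    exact (h j (by simp)).mul (ih fun i hi => h i (by simp [hi]))

theorem InjH_of_inv {a b e : ℕ} (f : Matrix (Fin b) (Fin a) R) (g : Matrix (Fin e) (Fin b) R)
    (N : Submodule R V) (y : R)
    (h : ∀ x : Fin b → V, ∃ s : R, s • y • x - x ∈ tup N b) : InjH f g N y := by
  rintro x hx ⟨w, hw⟩
  obtain ⟨s, hs⟩ := h x
  refine ⟨s • w, ?_⟩
  have : x - act V f (s • w) = s • (y • x - act V f w) - (s • y • x - x) := by
    rw [map_smul, smul_sub]; abel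
  rw [this]
  exact Submodule.sub_mem _ (Submodule.smul_mem _ _ hw) hs

theorem InjH_of_Ex {a b e z : ℕ} (t : Matrix (Fin a) (Fin z) R) (f : Matrix (Fin b) (Fin a) R)
    (g : Matrix (Fin e) (Fin b) R) (hft : f * t = 0)
    (N : Submodule R V) (y : R) (hy : ∀ v : V, y • v ∈ N → v ∈ N)
    (h : Ex t f (N ⊔ rng V y)) : InjH f g N y := by
  rintro x hx ⟨w, hw⟩
  have h1 : act V f w ∈ tup (N ⊔ rng V y) b := by
    rw [mem_tup_sup]
    refine ⟨-(y • x - act V f w), Submodule.neg_mem _ hw, x, by abel⟩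
  obtain ⟨u, hu⟩ := h w h1
  obtain ⟨m, hm, v, hv⟩ := mem_tup_sup.mp hu
  have h2 : act V f w = act V f m + y • act V f v := by
    have : w = act V t u + (m + y • v) := by rw [← hv]; abel
    rw [this, map_add, ← act_mul, hft, act_zero, zero_add, map_add, map_smul]
  refine ⟨v, mem_tup.mpr fun p => hy _ ?_⟩
  have h3 : y • (x - act V f v) = (y • x - act V f w) + act V f m := by
    rw [h2, smul_sub]; abel
  have := mem_tup.mp (Submodule.add_mem _ hw (act_mem_tup f hm)) p
  rw [← h3] at this
  exact this

theorem Ex_of_null {a b e : ℕ} (f : Matrix (Fin b) (Fin a) R) (g : Matrix (Fin e) (Fin b) R)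
    (N : Submodule R V) (y : R) (H : Matrix (Fin a) (Fin b) R) (H' : Matrix (Fin b) (Fin e) R)
    (hn : f * H + H' * g = y • (1 : Matrix (Fin b) (Fin b) R)) (hy : InjH f g N y) : Ex f g N := by
  intro x hx
  apply hy x hx
  refine ⟨act V H x, ?_⟩
  rw [← act_smul_one, ← hn, act_add, act_mul, act_mul, add_sub_cancel_left]
  exact act_mem_tup _ hx

end acyc
end MC

namespace MC
section acyc2
variable {k : Type} [Field k] {c : ℕ}

/-- the identity, forgetting the twisted action -/
def ofV {A : Finset (Fin c)} : VA k c A ≃+ MvPolynomial (Fin c) k :=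
  AddEquiv.refl (MvPolynomial (Fin c) k)

theorem ofV_smul {A : Finset (Fin c)} (f : MvPolynomial (Fin c) k) (v : VA k c A) :
    ofV (f • v) = rho A f (ofV v) := rfl

theorem smul_X_of_notMem {A : Finset (Fin c)} {l : Fin c} (hl : l ∉ A) (v : VA k c A) :
    ofV ((X l : MvPolynomial (Fin c) k) • v) = X l * ofV v := by
  rw [ofV_smul, rho_X, xop, if_neg hl]
  exact sh_one l _

theorem smul_X_of_mem {A : Finset (Fin c)} {l : Fin c} (hl : l ∈ A) (v : VA k c A) :
    ofV ((X l : MvPolynomial (Fin c) k) • v) = sh l (-1) (ofV v) := by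
  rw [ofV_smul, rho_X, xop, if_pos hl]

theorem smul_C_VA {A : Finset (Fin c)} (a : k) (v : VA k c A) :
    ofV ((C a : MvPolynomial (Fin c) k) • v) = a • ofV v := by
  rw [ofV_smul]; exact rho_C A a _

theorem smul_lin {A : Finset (Fin c)} {l : Fin c} (hl : l ∉ A) (a : k) (v : VA k c A) :
    ofV ((X l - C a : MvPolynomial (Fin c) k) • v) = (X l - C a) * ofV v := by
  rw [sub_smul, map_sub, smul_X_of_notMem hl, smul_C_VA, sub_mul, smul_eq_C_mul]

/-- the submodule generated by linear forms -/
def NB (A B : Finset (Fin c)) (μ : Fin c → k) : Submodule (MvPolynomial (Fin c) k) (VA k c A) :=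
  B.sup fun l => rng (VA k c A) (X l - C (μ l))

/-- partial evaluation -/
def theta (B : Finset (Fin c)) (μ : Fin c → k) : MvPolynomial (Fin c) k →ₐ[k] MvPolynomial (Fin c) k :=
  aeval fun l => if l ∈ B then C (μ l) else X l

theorem theta_lin (B : Finset (Fin c)) (μ : Fin c → k) (l : Fin c) (hl : l ∈ B) :
    theta B μ (X l - C (μ l)) = 0 := by
  simp [theta, hl, algebraMap_eq]

theorem theta_lin' (B : Finset (Fin c)) (μ : Fin c → k) (a : k) (l : Fin c) (hl : l ∉ B) :
    theta B μ (X l - C a) = X l - C a := by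
  simp [theta, hl, algebraMap_eq]

theorem theta_of_mem {A B : Finset (Fin c)} (hAB : Disjoint A B) (μ : Fin c → k) (v : VA k c A)
    (hv : v ∈ NB A B μ) : theta B μ (ofV v) = 0 := by
  rw [NB, Finset.sup_eq_iSup] at hv
  induction hv using Submodule.iSup_induction' with
  | mem l x hx =>
    by_cases hl : l ∈ B
    · simp only [hl, iSup_pos] at hx
      obtain ⟨w, rfl⟩ := hx
      have hlA : l ∉ A := Finset.disjoint_right.mp hAB hl
      rw [LinearMap.lsmul_apply, smul_lin hlA, map_mul, theta_lin B μ l hl, zero_mul]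
    · simp only [hl, not_false_eq_true, iSup_neg, Submodule.mem_bot] at hx
      rw [hx, map_zero, map_zero]
  | zero => rw [map_zero, map_zero]
  | add x y _ _ hx hy => rw [map_add, map_add, hx, hy, add_zero]

theorem sub_theta_mem (B : Finset (Fin c)) (μ : Fin c → k) (v : MvPolynomial (Fin c) k) :
    v - theta B μ v ∈ ⨆ l ∈ B, Ideal.span {(X l - C (μ l) : MvPolynomial (Fin c) k)} := by
  set J := ⨆ l ∈ B, Ideal.span {(X l - C (μ l) : MvPolynomial (Fin c) k)} with hJ
  rw [← Ideal.Quotient.eq]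
  have : (Ideal.Quotient.mkₐ k J) = (Ideal.Quotient.mkₐ k J).comp (theta B μ) := by
    apply MvPolynomial.algHom_ext
    intro l
    simp only [AlgHom.comp_apply, theta, aeval_X]
    split_ifs with h
    · simp only [Ideal.Quotient.mkₐ_eq_mk]
      rw [Ideal.Quotient.eq]
      exact (le_iSup₂_of_le (f := fun l (_ : l ∈ B) => Ideal.span {(X l - C (μ l) : MvPolynomial (Fin c) k)}) l h le_rfl) (Ideal.subset_span rfl)
    · rfl
  exact DFunLike.congr_fun this v

theorem mem_of_theta {A B : Finset (Fin c)} (hAB : Disjoint A B) (μ : Fin c → k) (v : VA k c A)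
    (hv : theta B μ (ofV v) = 0) : v ∈ NB A B μ := by
  have h := sub_theta_mem B μ (ofV v)
  rw [hv, sub_zero] at h
  have key : ∀ w : MvPolynomial (Fin c) k,
      w ∈ (⨆ l ∈ B, Ideal.span {(X l - C (μ l) : MvPolynomial (Fin c) k)}) →
      ofV.symm w ∈ NB A B μ := by
    intro w hw
    induction hw using Submodule.iSup_induction' with
    | mem l x hx =>
      by_cases hl : l ∈ B
      · simp only [hl, iSup_pos] at hx
        obtain ⟨u, hu⟩ := Ideal.mem_span_singleton'.mp hx
        have hlA : l ∉ A := Finset.disjoint_right.mp hAB hl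
        have : rng (VA k c A) (X l - C (μ l)) ≤ NB A B μ :=
          Finset.le_sup (f := fun l => rng (VA k c A) (X l - C (μ l))) hl
        apply this
        refine ⟨ofV.symm u, ?_⟩
        apply ofV.injective
        rw [LinearMap.lsmul_apply, smul_lin hlA, ← hu, mul_comm]
        simp
      · simp only [hl, not_false_eq_true, iSup_neg, Submodule.mem_bot] at hx
        rw [hx, map_zero]; exact Submodule.zero_mem _
    | zero => rw [map_zero]; exact Submodule.zero_mem _
    | add x y _ _ hx hy =>
      rw [map_add]; exact Submodule.add_mem (NB A B μ) hx hy
  have := key _ h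
  rwa [AddEquiv.symm_apply_apply] at this

theorem X_sub_C_ne_zero' (l : Fin c) (a : k) : (X l - C a : MvPolynomial (Fin c) k) ≠ 0 := by
  intro h
  have := congrArg (MvPolynomial.eval fun _ => a + 1) h
  simp at this

theorem inj_mod {A B : Finset (Fin c)} (hAB : Disjoint A B) (μ : Fin c → k) (l : Fin c) (hlA : l ∉ A)
    (hlB : l ∉ B) (a : k) (v : VA k c A)
    (hv : (X l - C a : MvPolynomial (Fin c) k) • v ∈ NB A B μ) : v ∈ NB A B μ := by
  apply mem_of_theta hAB
  have := theta_of_mem hAB μ _ hv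
  rw [smul_lin hlA, map_mul, theta_lin' B μ a l hlB] at this
  exact (mul_eq_zero.mp this).resolve_left (X_sub_C_ne_zero' l a)

theorem NB_insert {A B : Finset (Fin c)} (μ : Fin c → k) (l : Fin c)
    (hlB : l ∉ B) (a : k) :
    NB A (insert l B) (Function.update μ l a) = NB A B μ ⊔ rng (VA k c A) (X l - C a) := by
  rw [NB, Finset.sup_insert, sup_comm, NB]
  congr 1
  · apply Finset.sup_congr rfl
    intro j hj
    rw [Function.update_of_ne (by rintro rfl; exact hlB hj)]
  · simp

theorem lin_act_mod {A B : Finset (Fin c)} (μ : Fin c → k) (l : Fin c)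
    (hlB : l ∈ B) (a : k) (v : VA k c A) :
    (X l - C a : MvPolynomial (Fin c) k) • v - (C (μ l - a) : MvPolynomial (Fin c) k) • v ∈ NB A B μ := by
  have : rng (VA k c A) (X l - C (μ l)) ≤ NB A B μ :=
    Finset.le_sup (f := fun l => rng (VA k c A) (X l - C (μ l))) hlB
  apply this
  refine ⟨v, ?_⟩
  rw [LinearMap.lsmul_apply, ← sub_smul, C_sub]
  congr 1
  ring

/-- local nilpotency of contraction -/
theorem nilp {A : Finset (Fin c)} {l : Fin c} (hl : l ∈ A) (v : VA k c A) :
    ∃ r : ℕ, (X l ^ r : MvPolynomial (Fin c) k) • v = 0 := by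
  have h1 : ∀ r : ℕ, ofV ((X l ^ r : MvPolynomial (Fin c) k) • v) = sh l (-(r : ℤ)) (ofV v) := by
    intro r
    induction r with
    | zero => simp only [pow_zero, one_smul, Nat.cast_zero, neg_zero]; exact (sh_zero l _).symm
    | succ r ih =>
      rw [pow_succ', mul_smul, smul_X_of_mem hl, ih, sh_sh _ _ _ (Or.inl (by norm_num))]
      congr 2; push_cast; ring
  refine ⟨MvPolynomial.degreeOf l (ofV v) + 1, ?_⟩
  apply ofV.injective
  rw [h1, map_zero, sh_eq_zero l _ (by positivity)]
  intro m hm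
  have := MvPolynomial.monomial_le_degreeOf l hm
  push_cast
  omega

theorem nilp_tup {A : Finset (Fin c)} {l : Fin c} (hl : l ∈ A) {b : ℕ} (v : Fin b → VA k c A) :
    ∃ r : ℕ, (X l ^ r : MvPolynomial (Fin c) k) • v = 0 := by
  choose r hr using fun p => nilp hl (v p)
  refine ⟨∑ p, r p, ?_⟩
  funext p
  rw [Pi.smul_apply, ← Finset.sum_erase_add _ _ (Finset.mem_univ p), pow_add, mul_smul, hr, smul_zero]
  rfl

theorem inv_of_mem {A : Finset (Fin c)} {l : Fin c} (hl : l ∈ A) (a : k) {b : ℕ}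
    (v : Fin b → VA k c A) :
    ∃ s : MvPolynomial (Fin c) k, s • (1 - C a * X l : MvPolynomial (Fin c) k) • v = v := by
  obtain ⟨r, hr⟩ := nilp_tup hl v
  refine ⟨∑ i ∈ Finset.range r, (C a * X l) ^ i, ?_⟩
  rw [smul_smul, geom_sum_mul_neg, sub_smul, one_smul, mul_pow, mul_smul, hr, smul_zero, sub_zero]

/-- the linear factors in the chart `A` -/
def fac (A : Finset (Fin c)) (lam : Fin c → Fin c → k) (j l : Fin c) : MvPolynomial (Fin c) k :=
  if l ∈ A then 1 - C (lam j l) * X l else X l - C (lam j l)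

/-- the multihomogeneous forms in the chart `A` -/
def ZZ (A : Finset (Fin c)) (lam : Fin c → Fin c → k) (j : Fin c) : MvPolynomial (Fin c) k :=
  ∏ l, fac A lam j l

/-- one step of the induction -/
theorem step {A B : Finset (Fin c)} (hAB : Disjoint A B) (lam : Fin c → Fin c → k)
    (μ : Fin c → k) (j : Fin c) (hμ : ∀ l ∈ B, μ l ≠ lam j l)
    {a b e z : ℕ} (t : Matrix (Fin a) (Fin z) (MvPolynomial (Fin c) k))
    (f : Matrix (Fin b) (Fin a) (MvPolynomial (Fin c) k))
    (g : Matrix (Fin e) (Fin b) (MvPolynomial (Fin c) k)) (hft : f * t = 0)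
    (r : ℕ) (H : Matrix (Fin a) (Fin b) (MvPolynomial (Fin c) k))
    (H' : Matrix (Fin b) (Fin e) (MvPolynomial (Fin c) k))
    (hn : f * H + H' * g = (ZZ A lam j) ^ r • (1 : Matrix (Fin b) (Fin b) (MvPolynomial (Fin c) k)))
    (hex : ∀ l, l ∉ A → l ∉ B → Ex t f (NB A (insert l B) (Function.update μ l (lam j l)))) :
    Ex f g (NB A B μ) := by
  apply Ex_of_null f g _ _ H H' hn
  apply InjH.pow
  apply InjH.prod
  intro l _
  by_cases hlA : l ∈ A
  · apply InjH_of_inv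
    intro x
    rw [fac, if_pos hlA]
    obtain ⟨s, hs⟩ := inv_of_mem hlA (lam j l) x
    exact ⟨s, by rw [hs, sub_self]; exact Submodule.zero_mem _⟩
  rw [fac, if_neg hlA]
  by_cases hlB : l ∈ B
  · apply InjH_of_inv
    intro x
    have hne : μ l - lam j l ≠ 0 := sub_ne_zero.mpr (hμ l hlB)
    refine ⟨C ((μ l - lam j l)⁻¹), mem_tup.mpr fun p => ?_⟩
    have h1 := Submodule.smul_mem _ (C ((μ l - lam j l)⁻¹) : MvPolynomial (Fin c) k)
      (lin_act_mod μ l hlB (lam j l) (x p))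
    rw [smul_sub, smul_smul (C ((μ l - lam j l)⁻¹)) (C (μ l - lam j l)), ← C_mul, inv_mul_cancel₀ hne, C_1, one_smul] at h1
    exact h1
  · apply InjH_of_Ex t f g hft
    · intro v hv
      exact inj_mod hAB μ l hlA hlB _ v hv
    · rw [← NB_insert μ l hlB]
      exact hex l hlA hlB

end acyc2
end MC

namespace MC
section acyc3

/-- `y` is null-homotopic on the complex `M` -/
def NullH {R : Type} [CommRing R] {rk : ℕ → ℕ}
    (M : ∀ i, Matrix (Fin (rk i)) (Fin (rk (i+1))) R) (y : R) : Prop :=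
  ∃ H : ∀ i, Matrix (Fin (rk (i+1))) (Fin (rk i)) R,
    M 0 * H 0 = y • (1 : Matrix (Fin (rk 0)) (Fin (rk 0)) R) ∧
    ∀ i, M (i+1) * H (i+1) + H i * M i = y • (1 : Matrix (Fin (rk (i+1))) (Fin (rk (i+1))) R)

variable {k : Type} [Field k] {c : ℕ}

theorem Ex_of_empty {R : Type} [CommRing R] {V : Type} [AddCommGroup V] [Module R V]
    {a b e : ℕ} (hb : b = 0) (f : Matrix (Fin b) (Fin a) R)
    (g : Matrix (Fin e) (Fin b) R) (N : Submodule R V) : Ex f g N := by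
  subst hb
  intro x _
  exact ⟨0, mem_tup.mpr fun p => p.elim0⟩

theorem mu_step {lam : Fin c → Fin c → k} {B : Finset (Fin c)} {μ : Fin c → k} {m : ℕ}
    (hμ : ∀ l ∈ B, ∃ j : Fin c, (j : ℕ) < m ∧ μ l = lam j l) (j : Fin c) (hj : (j : ℕ) = m) (l : Fin c) :
    ∀ l' ∈ insert l B, ∃ j' : Fin c, (j' : ℕ) < m + 1 ∧ Function.update μ l (lam j l) l' = lam j' l' := by
  intro l' hl'
  by_cases h : l' = l
  · subst h; exact ⟨j, by omega, by simp⟩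
  · rw [Finset.mem_insert] at hl'
    obtain ⟨j', h1, h2⟩ := hμ l' (hl'.resolve_left h)
    exact ⟨j', by omega, by rw [Function.update_of_ne h, h2]⟩

theorem acyc {A : Finset (Fin c)} {lam : Fin c → Fin c → k}
    (hlam : ∀ l, Function.Injective fun j => lam j l)
    {rk : ℕ → ℕ} (hrk : ∀ i, c < i → rk i = 0)
    (M : ∀ i, Matrix (Fin (rk i)) (Fin (rk (i+1))) (MvPolynomial (Fin c) k))
    (hM : ∀ i, M i * M (i+1) = 0) (r : ℕ) (hN : ∀ j, NullH M (ZZ A lam j ^ r)) :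
    ∀ s m, m + s = c → ∀ B : Finset (Fin c), Disjoint A B → B.card = m → ∀ μ : Fin c → k,
      (∀ l ∈ B, ∃ j : Fin c, (j : ℕ) < m ∧ μ l = lam j l) →
      (∀ i, A.Nonempty ∨ m < i + 1 → Ex (M (i+1)) (M i) (NB A B μ)) ∧
      (A.Nonempty → Ex (M 0) (0 : Matrix (Fin 0) (Fin (rk 0)) (MvPolynomial (Fin c) k)) (NB A B μ)) := by
  intro s
  induction s with
  | zero =>
    intro m hm B hAB hB μ hμ
    have hA : ¬ A.Nonempty := by
      rintro ⟨l, hl⟩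
      have h1 : B = Finset.univ := by
        rw [← Finset.card_eq_iff_eq_univ]; simp; omega
      exact Finset.disjoint_left.mp hAB hl (by rw [h1]; simp)
    refine ⟨fun i hi => ?_, fun h => (hA h).elim⟩
    exact Ex_of_empty (hrk _ (by have := hi.resolve_left hA; omega)) _ _ _
  | succ s ih =>
    intro m hm B hAB hB μ hμ
    have hmc : m < c := by omega
    set j : Fin c := ⟨m, hmc⟩ with hj
    have hne : ∀ l ∈ B, μ l ≠ lam j l := by
      intro l hl h
      obtain ⟨j', h1, h2⟩ := hμ l hl
      have := hlam l (h2.symm.trans h)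
      rw [this] at h1
      simp [hj] at h1
    obtain ⟨H, H0, H1⟩ := hN j
    have hIH := fun (l : Fin c) (hlA : l ∉ A) (hlB : l ∉ B) =>
      ih (m+1) (by omega) (insert l B) (by
        rw [Finset.disjoint_insert_right]; exact ⟨hlA, hAB⟩)
        (by rw [Finset.card_insert_of_notMem hlB, hB]) (Function.update μ l (lam j l))
        (mu_step hμ j rfl l)
    constructor
    · intro i hi
      exact step hAB lam μ j hne (M (i+2)) (M (i+1)) (M i) (hM _) r (H (i+1)) (H i) (H1 i)
        fun l hlA hlB => (hIH l hlA hlB).1 (i+1) (hi.imp id (by omega))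
    · intro hA
      refine step hAB lam μ j hne (M 1) (M 0) 0 (hM _) r (H 0) 0 (by rw [H0]; simp)
        fun l hlA hlB => (hIH l hlA hlB).1 0 (Or.inl hA)

/-- exactness of the dual complex -/
theorem acyc_dual {lam : Fin c → Fin c → k}
    (hlam : ∀ l, Function.Injective fun j => lam j l)
    {rk : ℕ → ℕ}
    (M : ∀ i, Matrix (Fin (rk i)) (Fin (rk (i+1))) (MvPolynomial (Fin c) k))
    (hM : ∀ i, M i * M (i+1) = 0) (r : ℕ) (hN : ∀ j, NullH M (ZZ ∅ lam j ^ r)) :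
    ∀ s m, m + s = c → ∀ B : Finset (Fin c), B.card = m → ∀ μ : Fin c → k,
      (∀ l ∈ B, ∃ j : Fin c, (j : ℕ) < m ∧ μ l = lam j l) →
      (∀ i, m + (i + 1) < c → Ex (M i).transpose (M (i+1)).transpose (NB ∅ B μ)) ∧
      (m < c → Ex (0 : Matrix (Fin (rk 0)) (Fin 0) (MvPolynomial (Fin c) k)) (M 0).transpose (NB ∅ B μ)) := by
  intro s
  induction s with
  | zero =>
    intro m hm B hB μ hμ
    exact ⟨fun i hi => by omega, fun hi => by omega⟩
  | succ s ih =>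
    intro m hm B hB μ hμ
    have hmc : m < c := by omega
    set j : Fin c := ⟨m, hmc⟩ with hj
    have hne : ∀ l ∈ B, μ l ≠ lam j l := by
      intro l hl h
      obtain ⟨j', h1, h2⟩ := hμ l hl
      have := hlam l (h2.symm.trans h)
      rw [this] at h1
      simp [hj] at h1
    obtain ⟨H, H0, H1⟩ := hN j
    have hIH := fun (l : Fin c) (hlB : l ∉ B) =>
      ih (m+1) (by omega) (insert l B)
        (by rw [Finset.card_insert_of_notMem hlB, hB]) (Function.update μ l (lam j l))
        (mu_step hμ j rfl l)
    have H0' : (H 0).transpose * (M 0).transpose = ZZ ∅ lam j ^ r • (1 : Matrix _ _ _) := by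
      rw [← Matrix.transpose_mul, H0]; simp
    have H1' : ∀ i, (M i).transpose * (H i).transpose + (H (i+1)).transpose * (M (i+1)).transpose
        = ZZ ∅ lam j ^ r • (1 : Matrix _ _ _) := by
      intro i
      rw [← Matrix.transpose_mul, ← Matrix.transpose_mul, ← Matrix.transpose_add, add_comm (H i * M i), H1]
      simp
    have hM' : ∀ i, (M (i+1)).transpose * (M i).transpose = 0 := by
      intro i; rw [← Matrix.transpose_mul, hM]; simp
    constructor
    · intro i hi
      cases i with
      | zero =>
        exact step (by simp) lam μ j hne (0 : Matrix (Fin (rk 0)) (Fin 0) _) (M 0).transpose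
          (M 1).transpose (by simp) r (H 0).transpose (H 1).transpose (H1' 0)
          fun l _ hlB => (hIH l hlB).2 (by omega)
      | succ i =>
        exact step (by simp) lam μ j hne (M i).transpose (M (i+1)).transpose
          (M (i+2)).transpose (hM' i) r (H (i+1)).transpose (H (i+2)).transpose (H1' (i+1))
          fun l _ hlB => (hIH l hlB).1 i (by omega)
    · intro _
      refine step (by simp) lam μ j hne (0 : Matrix (Fin 0) (Fin 0) _) 0
          (M 0).transpose (by simp) r 0 (H 0).transpose (by rw [H0']; simp)
          fun l _ hlB => Ex_of_empty rfl _ _ _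

/-- exactness modulo variables (the Hilbert syzygy theorem). -/
theorem syz {rk : ℕ → ℕ}
    (M : ∀ i, Matrix (Fin (rk i)) (Fin (rk (i+1))) (MvPolynomial (Fin c) k))
    (hM : ∀ i, M i * M (i+1) = 0)
    (hex : ∀ i, Ex (M (i+1)) (M i) (⊥ : Submodule _ (VA k c ∅))) (B : Finset (Fin c)) :
    ∀ i, B.card ≤ i → Ex (M (i+1)) (M i) (NB ∅ B (0 : Fin c → k)) := by
  induction B using Finset.induction_on with
  | empty => intro i _; exact hex i
  | insert l B hl ih =>
    intro i hi
    rw [Finset.card_insert_of_notMem hl] at hi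
    obtain ⟨i, rfl⟩ : ∃ j, i = j + 1 := ⟨i - 1, by omega⟩
    have : NB ∅ (insert l B) (0 : Fin c → k) = NB ∅ B 0 ⊔ rng (VA k c ∅) (X l - C 0) := by
      rw [← NB_insert _ _ hl]; congr 1; funext j; by_cases h : j = l
      · subst h; simp
      · simp [h]
    rw [this]
    apply Ex_down _ _ (M i) (hM i) _ _ _ (ih _ (by omega)) (ih _ (by omega))
    intro v hv
    exact inj_mod (by simp) _ l (by simp) hl _ v hv

end acyc3
end MC

namespace MC
section nullh

theorem NullH.add {R : Type} [CommRing R] {rk : ℕ → ℕ}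
    {M : ∀ i, Matrix (Fin (rk i)) (Fin (rk (i+1))) R} {y y' : R} (h : NullH M y)
    (h' : NullH M y') : NullH M (y + y') := by
  obtain ⟨H, h0, h1⟩ := h
  obtain ⟨H', h0', h1'⟩ := h'
  refine ⟨fun i => H i + H' i, ?_, fun i => ?_⟩
  · rw [Matrix.mul_add, h0, h0', add_smul]
  · rw [Matrix.mul_add, Matrix.add_mul, add_smul, ← h1 i, ← h1' i]; abel

theorem NullH.zero {R : Type} [CommRing R] {rk : ℕ → ℕ}
    {M : ∀ i, Matrix (Fin (rk i)) (Fin (rk (i+1))) R} : NullH M 0 :=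
  ⟨fun i => 0, by simp, fun i => by simp⟩

theorem NullH.smul {R : Type} [CommRing R] {rk : ℕ → ℕ}
    {M : ∀ i, Matrix (Fin (rk i)) (Fin (rk (i+1))) R} (a : R) {y : R} (h : NullH M y) :
    NullH M (a * y) := by
  obtain ⟨H, h0, h1⟩ := h
  refine ⟨fun i => a • H i, ?_, fun i => ?_⟩
  · rw [Matrix.mul_smul, h0, smul_smul]
  · rw [Matrix.mul_smul, Matrix.smul_mul, ← smul_add, h1, smul_smul]

theorem NullH.span {R : Type} [CommRing R] {rk : ℕ → ℕ}
    {M : ∀ i, Matrix (Fin (rk i)) (Fin (rk (i+1))) R} {s : Set R} (h : ∀ y ∈ s, NullH M y)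
    {y : R} (hy : y ∈ Ideal.span s) : NullH M y := by
  induction hy using Submodule.span_induction with
  | mem x hx => exact h x hx
  | zero => exact NullH.zero
  | add x y _ _ hx hy => exact hx.add hy
  | smul a x _ hx => exact hx.smul a

theorem NullH.map {R R' : Type} [CommRing R] [CommRing R'] (φ : R →+* R') {rk : ℕ → ℕ}
    {M : ∀ i, Matrix (Fin (rk i)) (Fin (rk (i+1))) R} {y : R} (h : NullH M y) :
    NullH (fun i => (M i).map φ) (φ y) := by
  obtain ⟨H, h0, h1⟩ := h
  have e : ∀ a : ℕ, (y • (1 : Matrix (Fin a) (Fin a) R)).map φ = φ y • (1 : Matrix (Fin a) (Fin a) R') := by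
    intro a
    ext p q
    simp [Matrix.one_apply, apply_ite φ]
  refine ⟨fun i => (H i).map φ, ?_, fun i => ?_⟩
  · rw [← Matrix.map_mul, h0, e]
  · rw [← Matrix.map_mul, ← Matrix.map_mul, ← Matrix.map_add φ (map_add φ), h1, e]

theorem lift_mat {R : Type} [CommRing R] {a b e z : ℕ} (g : Matrix (Fin a) (Fin b) R)
    (f : Matrix (Fin b) (Fin e) R)
    (h : LinearMap.ker g.mulVecLin = LinearMap.range f.mulVecLin) (N : Matrix (Fin b) (Fin z) R)
    (hN : g * N = 0) : ∃ H : Matrix (Fin e) (Fin z) R, f * H = N := by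
  have h1 : ∀ q, ∃ v : Fin e → R, f.mulVec v = N.col q := by
    intro q
    have : N.col q ∈ LinearMap.ker g.mulVecLin := by
      rw [LinearMap.mem_ker, Matrix.mulVecLin_apply]
      funext p
      have := congrFun (congrFun hN p) q
      exact this
    rw [h] at this
    exact this
  choose v hv using h1
  refine ⟨Matrix.of fun p q => v q p, ?_⟩
  ext p q
  exact congrFun (hv q) p

theorem nullH_exists (F : FreeComplex K n) (hF : IsResolution F) (y : PolyS K n)
    (H0 : Matrix (Fin (F.rk 1)) (Fin (F.rk 0)) (PolyS K n)) (hH0 : F.dd 0 * H0 = y • (1 : Matrix (Fin (F.rk 0)) (Fin (F.rk 0)) (PolyS K n))) :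
    NullH F.dd y := by
  have hstep : ∀ i (H : {H : Matrix (Fin (F.rk (i+1))) (Fin (F.rk i)) (PolyS K n) //
      F.dd i * H * F.dd i = y • F.dd i}),
      ∃ H' : {H : Matrix (Fin (F.rk (i+2))) (Fin (F.rk (i+1))) (PolyS K n) //
      F.dd (i+1) * H * F.dd (i+1) = y • F.dd (i+1)},
      F.dd (i+1) * H'.1 + H.1 * F.dd i = y • (1 : Matrix _ _ _) := by
    rintro i ⟨H, hH⟩
    obtain ⟨H', hH'⟩ := lift_mat (F.dd i) (F.dd (i+1)) (hF i) (y • (1 : Matrix _ _ _) - H * F.dd i) (by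
      rw [Matrix.mul_sub, ← Matrix.mul_assoc, hH]; simp)
    refine ⟨⟨H', ?_⟩, ?_⟩
    · rw [hH', Matrix.sub_mul, Matrix.mul_assoc, F.isComplex]; simp
    · rw [hH']; simp
  choose nxt hnxt using hstep
  let Hs : ∀ i, {H : Matrix (Fin (F.rk (i+1))) (Fin (F.rk i)) (PolyS K n) //
      F.dd i * H * F.dd i = y • F.dd i} := fun i =>
    Nat.rec ⟨H0, by rw [hH0]; simp⟩ (fun i H => nxt i H) i
  exact ⟨fun i => (Hs i).1, hH0, fun i => hnxt i (Hs i)⟩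

theorem nullH_gen (F : FreeComplex K n) (hF : IsResolution F) (hcyc : F.rk 0 = 1)
    (p : Fin (F.rk 0)) (q : Fin (F.rk 1)) : NullH F.dd (F.dd 0 p q) := by
  have hs : ∀ p' : Fin (F.rk 0), p' = p := by
    intro p'; apply Fin.ext; have := p.2; have := p'.2; omega
  apply nullH_exists F hF _ (Matrix.of fun a b => if a = q then 1 else 0)
  ext a b
  rw [hs a, hs b]
  simp [Matrix.mul_apply]

end nullh
end MC

namespace MC
section hilb

theorem finrank_homog (σ : Type) [Fintype σ] (e : ℕ) :
    finrank K (homogeneousSubmodule σ K e) = Nat.multichoose (Fintype.card σ) e := by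
  classical
  have h : homogeneousSubmodule σ K e = restrictSupport K {d : σ →₀ ℕ | d.degree = e} :=
    homogeneousSubmodule_eq_finsupp_supported σ K e
  rw [h, Module.finrank_eq_nat_card_basis (basisRestrictSupport K _), ← Sym.card_sym_eq_multichoose,
    ← Nat.card_eq_fintype_card]
  refine Nat.card_congr (Equiv.trans (Equiv.subtypeEquivRight fun d => ?_) (Sym.equivNatSum σ e).symm)
  simp [Finsupp.degree_apply, Finsupp.sum]

theorem finite_homog (σ : Type) [Fintype σ] (e : ℕ) :
    FiniteDimensional K (homogeneousSubmodule σ K e) :=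
  Module.Finite.iff_fg.mpr (homogeneousSubmodule_fg σ K e)

theorem mem_homogZ {z : ℤ} {f : PolyS K n} :
    f ∈ homogZ K n z ↔ (0 ≤ z ∧ f.IsHomogeneous z.toNat) ∨ f = 0 := by
  unfold homogZ
  by_cases h : 0 ≤ z
  · simp only [h, iSup_pos, mem_homogeneousSubmodule, true_and]
    constructor
    · exact Or.inl
    · rintro (h | rfl)
      · exact h
      · exact isHomogeneous_zero _ _ _
  · simp [h]

theorem homogZ_of_nonneg {z : ℤ} (h : 0 ≤ z) :
    homogZ K n z = homogeneousSubmodule (Fin n) K z.toNat := by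
  unfold homogZ; simp [h]

theorem homogZ_of_neg {z : ℤ} (h : z < 0) : homogZ K n z = ⊥ := by
  unfold homogZ; simp [h]

theorem homogZ_mul {a b : ℤ} {f g : PolyS K n} (hf : f ∈ homogZ K n a) (hg : g ∈ homogZ K n b) :
    f * g ∈ homogZ K n (a + b) := by
  rw [mem_homogZ] at *
  rcases hf with ⟨ha, hf⟩ | rfl
  · rcases hg with ⟨hb, hg⟩ | rfl
    · left
      refine ⟨by omega, ?_⟩
      have := hf.mul hg
      rwa [← Int.toNat_add ha hb] at this
    · right; simp
  · right; simp

/-- the component of degree `z` -/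
def compZ (z : ℤ) : PolyS K n →ₗ[K] PolyS K n :=
  if 0 ≤ z then homogeneousComponent z.toNat else 0

theorem compZ_mem (z : ℤ) (f : PolyS K n) : compZ z f ∈ homogZ K n z := by
  rw [mem_homogZ, compZ]
  split_ifs with h
  · exact Or.inl ⟨h, homogeneousComponent_isHomogeneous _ _⟩
  · right; rfl

theorem compZ_of_mem {z w : ℤ} {f : PolyS K n} (hf : f ∈ homogZ K n z) :
    compZ w f = if w = z then f else 0 := by
  rw [mem_homogZ] at hf
  rcases hf with ⟨h0, hf⟩ | rfl
  · rw [compZ]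
    by_cases hw : 0 ≤ w
    · rw [if_pos hw, homogeneousComponent_of_mem hf]
      congr 1
      apply propext
      omega
    · rw [if_neg hw, if_neg (by omega)]; rfl
  · simp

theorem compZ_mul {a z : ℤ} {f : PolyS K n} (hf : f ∈ homogZ K n a) (g : PolyS K n) :
    compZ z (f * g) = f * compZ (z - a) g := by
  have hg : g = ∑ i ∈ Finset.range (g.totalDegree + 1), homogeneousComponent i g :=
    (sum_homogeneousComponent g).symm
  rw [hg, Finset.mul_sum, map_sum, map_sum, Finset.mul_sum]
  refine Finset.sum_congr rfl fun i _ => ?_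
  have h1 : homogeneousComponent i g ∈ homogZ K n (i : ℤ) := by
    rw [mem_homogZ]; exact Or.inl ⟨by omega, by simpa using homogeneousComponent_isHomogeneous i g⟩
  rw [compZ_of_mem (homogZ_mul hf h1), compZ_of_mem h1]
  by_cases h : z = a + i
  · rw [if_pos h, if_pos (by omega)]
  · rw [if_neg h, if_neg (by omega), mul_zero]

/-- the strand map -/
theorem strand_mem (F : FreeComplex K n) (i : ℕ) (ℓ : ℤ) (v : Fin (F.rk (i+1)) → PolyS K n)
    (hv : v ∈ freePiece (F.deg (i+1)) ℓ) : (F.dd i).mulVec v ∈ freePiece (F.deg i) ℓ := by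
  simp only [freePiece, Submodule.mem_pi, Set.mem_univ, true_implies] at *
  intro p
  rw [Matrix.mulVec, dotProduct]
  refine Submodule.sum_mem _ fun q _ => ?_
  have := homogZ_mul (F.isHomog i p q) (hv q)
  have e : F.deg (i+1) q - F.deg i p + (ℓ - F.deg (i+1) q) = ℓ - F.deg i p := by ring
  rwa [e] at this

/-- the strand differential -/
def sd (F : FreeComplex K n) (ℓ : ℤ) (i : ℕ) :
    freePiece (K := K) (n := n) (F.deg (i+1)) ℓ →ₗ[K] freePiece (K := K) (n := n) (F.deg i) ℓ :=
  LinearMap.restrict ((F.dd i).mulVecLin.restrictScalars K) fun v hv => strand_mem F i ℓ v hv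

theorem strand_comp (F : FreeComplex K n) (i : ℕ) (ℓ : ℤ) (w : Fin (F.rk (i+1)) → PolyS K n)
    (hv : (F.dd i).mulVec w ∈ freePiece (F.deg i) ℓ) :
    ∃ w' ∈ freePiece (F.deg (i+1)) ℓ, (F.dd i).mulVec w' = (F.dd i).mulVec w := by
  refine ⟨fun q => compZ (ℓ - F.deg (i+1) q) (w q), ?_, ?_⟩
  · simp only [freePiece, Submodule.mem_pi, Set.mem_univ, true_implies]
    exact fun q => compZ_mem _ _
  · funext p
    simp only [freePiece, Submodule.mem_pi, Set.mem_univ, true_implies] at hv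
    have h1 := compZ_of_mem (w := ℓ - F.deg i p) (hv p)
    rw [if_pos rfl] at h1
    rw [← h1]
    simp only [Matrix.mulVec, dotProduct, map_sum]
    refine Finset.sum_congr rfl fun q _ => ?_
    rw [compZ_mul (F.isHomog i p q)]
    congr 2
    ring

theorem sd_exact (F : FreeComplex K n) (hF : IsResolution F) (ℓ : ℤ) (i : ℕ) :
    LinearMap.ker (sd F ℓ i) = LinearMap.range (sd F ℓ (i+1)) := by
  ext ⟨v, hv⟩
  rw [LinearMap.mem_ker]
  have e : ∀ (i : ℕ) (v) (hv), ((sd F ℓ i ⟨v, hv⟩ : freePiece (K := K) (n := n) (F.deg i) ℓ) :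
    Fin (F.rk i) → PolyS K n) = (F.dd i).mulVec v := fun i v hv => rfl
  constructor
  · intro h
    have h1 : v ∈ LinearMap.ker (F.dd i).mulVecLin := by
      rw [LinearMap.mem_ker]
      exact congrArg Subtype.val h
    rw [hF i] at h1
    obtain ⟨w, rfl⟩ := h1
    obtain ⟨w', hw', h2⟩ := strand_comp F (i+1) ℓ w hv
    exact ⟨⟨w', hw'⟩, Subtype.ext h2⟩
  · rintro ⟨⟨w, hw⟩, h⟩
    have h1 := congrArg Subtype.val h
    rw [e] at h1
    simp only at h1
    subst h1
    apply Subtype.ext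
    rw [e, Matrix.mulVec_mulVec, F.isComplex]
    simp

/-- a graded piece as a product -/
def freePieceEquiv {r : ℕ} (dg : Fin r → ℤ) (ℓ : ℤ) :
    freePiece (K := K) (n := n) dg ℓ ≃ₗ[K] (∀ p, homogZ K n (ℓ - dg p)) where
  toFun v p := ⟨v.1 p, by
    have := v.2
    simp only [freePiece, Submodule.mem_pi, Set.mem_univ, true_implies] at this
    exact this p⟩
  invFun w := ⟨fun p => (w p).1, by
    simp only [freePiece, Submodule.mem_pi, Set.mem_univ, true_implies]
    exact fun p => (w p).2⟩
  map_add' _ _ := rfl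
  map_smul' _ _ := rfl
  left_inv _ := rfl
  right_inv _ := rfl

instance finite_homogZ (z : ℤ) : FiniteDimensional K (homogZ K n z) := by
  by_cases h : 0 ≤ z
  · rw [homogZ_of_nonneg h]; exact finite_homog _ _
  · rw [homogZ_of_neg (by omega)]; infer_instance

instance finite_freePiece {r : ℕ} (dg : Fin r → ℤ) (ℓ : ℤ) :
    FiniteDimensional K (freePiece (K := K) (n := n) dg ℓ) :=
  Module.Finite.equiv (freePieceEquiv dg ℓ).symm

theorem multichoose_eval {n : ℕ} (hn : n ≠ 0) (a : ℤ) (ℓ : ℤ) (h : a ≤ ℓ) :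
    (Nat.multichoose n (ℓ - a).toNat : ℚ) = (genHilb n a).eval (ℓ : ℚ) := by
  obtain ⟨m, rfl⟩ : ∃ m, n = m + 1 := ⟨n - 1, by omega⟩
  obtain ⟨e, he⟩ : ∃ e : ℕ, ℓ - a = e := ⟨(ℓ - a).toNat, by omega⟩
  have he' : (ℓ : ℚ) - a = e := by exact_mod_cast he
  rw [genHilb, if_neg hn, he, Int.toNat_natCast, Nat.multichoose_eq]
  simp only [Nat.add_sub_cancel, Polynomial.eval_mul, Polynomial.eval_C, Polynomial.eval_prod,
    Polynomial.eval_add, Polynomial.eval_sub, Polynomial.eval_X, he']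
  have h1 := Nat.ascFactorial_eq_factorial_mul_choose e m
  rw [Nat.ascFactorial_eq_prod_range] at h1
  have h2 : (∏ x ∈ Finset.range m, ((e : ℚ) + (x + 1))) = m.factorial * (e + m).choose m := by
    rw [← Nat.cast_mul, ← h1]; push_cast
    exact Finset.prod_congr rfl fun x _ => by ring
  rw [h2, ← mul_assoc, inv_mul_cancel₀ (by exact_mod_cast m.factorial_ne_zero), one_mul]
  have : m + 1 + e - 1 = e + m := by omega
  rw [this]
  rw [Nat.choose_symm_add]

theorem finrank_freePiece {r : ℕ} (hn : n ≠ 0) (dg : Fin r → ℤ) (ℓ : ℤ) (h : ∀ p, dg p ≤ ℓ) :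
    (finrank K (freePiece (K := K) (n := n) dg ℓ) : ℚ) = ∑ p, (genHilb n (dg p)).eval (ℓ : ℚ) := by
  rw [(freePieceEquiv dg ℓ).finrank_eq, Module.finrank_pi_fintype]
  push_cast
  refine Finset.sum_congr rfl fun p _ => ?_
  rw [homogZ_of_nonneg (by have := h p; omega), finrank_homog, Fintype.card_fin,
    multichoose_eval hn _ _ (h p)]

theorem strand_euler (F : FreeComplex K n) (hF : IsResolution F) (hn : n ≠ 0) (ℓ : ℤ)
    (hℓ : ∀ i p, F.deg i p ≤ ℓ) :
    (finrank K (freePiece (K := K) (n := n) (F.deg 0) ℓ) : ℚ) -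
      finrank K (LinearMap.range (sd F ℓ 0)) = (hilbPoly F).eval (ℓ : ℚ) := by
  rw [euler_char (fun i => freePiece (K := K) (n := n) (F.deg i) ℓ) (sd F ℓ) (sd_exact F hF ℓ) F.len]
  · rw [hilbPoly, Polynomial.eval_finsetSum]
    refine Finset.sum_congr rfl fun i _ => ?_
    rw [finrank_freePiece hn _ _ (hℓ i), Polynomial.eval_mul, Polynomial.eval_C,
      Polynomial.eval_finsetSum]
  · intro i hi
    have h0 := F.rk_eq_zero i hi
    rw [(freePieceEquiv (F.deg i) ℓ).finrank_eq, Module.finrank_pi_fintype]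
    haveI : IsEmpty (Fin (F.rk i)) := by rw [h0]; infer_instance
    simp

theorem deg_bound (F : FreeComplex K n) : ∃ D : ℤ, ∀ i p, F.deg i p ≤ D := by
  have h : ∀ i, ∃ D : ℕ, ∀ p, F.deg i p ≤ D := by
    intro i
    refine ⟨∑ p, (F.deg i p).toNat, fun p => ?_⟩
    have := Finset.single_le_sum (f := fun p => (F.deg i p).toNat) (fun _ _ => Nat.zero_le _) (Finset.mem_univ p)
    omega
  choose D hD using h
  refine ⟨∑ i ∈ Finset.range (F.len + 1), (D i : ℤ), fun i p => (hD i p).trans ?_⟩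
  have hi : i ∈ Finset.range (F.len + 1) := by
    by_contra h
    have h0 := F.rk_eq_zero i (by simpa using h)
    exact absurd p.2 (by omega)
  exact Finset.single_le_sum (f := fun i => (D i : ℤ)) (fun _ _ => by positivity) hi

end hilb
end MC

namespace MC
section hilb2

/-- the basic monic polynomial -/
def gp (n : ℕ) : Polynomial ℚ := ∏ k ∈ Finset.range (n - 1), (Polynomial.X + Polynomial.C ((k : ℚ) + 1))

theorem gp_monic (n : ℕ) : (gp n).Monic :=
  Polynomial.monic_prod_of_monic _ _ fun _ _ => Polynomial.monic_X_add_C _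

theorem gp_natDegree (n : ℕ) : (gp n).natDegree = n - 1 := by
  rw [gp, Polynomial.natDegree_prod_of_monic _ _ fun _ _ => Polynomial.monic_X_add_C _]
  simp only [Polynomial.natDegree_X_add_C]
  simp

theorem genHilb_eq {n : ℕ} (hn : n ≠ 0) (a : ℤ) :
    genHilb n a = Polynomial.C (((n - 1).factorial : ℚ))⁻¹ *
      (gp n).comp (Polynomial.X - Polynomial.C (a : ℚ)) := by
  rw [genHilb, if_neg hn, gp, Polynomial.prod_comp]
  simp

theorem hilb_degree (F : FreeComplex K n) (c : ℕ) (h : polyDim (hilbPoly F) = n - c) :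
    (hilbPoly F).degree < ((n - c : ℕ) : WithBot ℕ) := by
  rw [polyDim] at h
  split_ifs at h with h0
  · rw [h0, Polynomial.degree_zero]; exact WithBot.bot_lt_coe _
  · rw [Polynomial.degree_eq_natDegree h0]
    exact_mod_cast (by omega)

theorem poly_contra (P : Polynomial ℚ) (r : ℕ) (hr : r ≠ 0) (hP : P.degree < r)
    (h2 : P.degree < ((r - 1 : ℕ) : WithBot ℕ)) (D : ℤ)
    (h : ∀ ℓ : ℤ, D ≤ ℓ → (genHilb r 0).eval (ℓ : ℚ) ≤ P.eval (ℓ : ℚ)) : False := by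
  have hlead : (genHilb r 0).leadingCoeff = (((r - 1).factorial : ℚ))⁻¹ := by
    rw [genHilb_eq hr]; simp [gp_monic r]
  have hpos : (0 : ℚ) < (((r - 1).factorial : ℚ))⁻¹ := by positivity
  have hdeg : (genHilb r 0).degree = ((r - 1 : ℕ) : WithBot ℕ) := by
    rw [Polynomial.degree_eq_natDegree (by
      intro h0; rw [h0] at hlead; simp only [Polynomial.leadingCoeff_zero] at hlead; linarith)]
    rw [genHilb_eq hr]
    rw [Polynomial.natDegree_C_mul (by positivity)]
    simp [gp_natDegree]
  rw [← hdeg] at h2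
  set Q := Polynomial.X * (genHilb r 0 - P) with hQ
  have hl : Q.leadingCoeff = (((r - 1).factorial : ℚ))⁻¹ := by
    rw [hQ, Polynomial.leadingCoeff_mul, Polynomial.leadingCoeff_sub_of_degree_lt h2, hlead]; simp
  have hd : 0 < Q.degree := by
    rw [hQ, Polynomial.degree_mul, Polynomial.degree_sub_eq_left_of_degree_lt h2, hdeg, Polynomial.degree_X]
    exact_mod_cast (by omega)
  have ht := Polynomial.tendsto_atTop_of_leadingCoeff_nonneg Q hd (by rw [hl]; exact hpos.le)
  have ht2 := ht.comp (tendsto_natCast_atTop_atTop (R := ℚ))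
  have h3 := ht2.eventually (Filter.eventually_gt_atTop 0)
  obtain ⟨N, hN⟩ := Filter.eventually_atTop.mp h3
  have h4 := hN (max N D.toNat) (le_max_left _ _)
  have h5 := h ((max N D.toNat : ℕ) : ℤ) (by
    have := le_max_right N D.toNat; omega)
  simp only [Function.comp_apply, hQ, Polynomial.eval_mul, Polynomial.eval_X,
    Polynomial.eval_sub] at h4
  rw [Int.cast_natCast] at h5
  have h6 : (0 : ℚ) ≤ ((max N D.toNat : ℕ) : ℚ) := by positivity
  nlinarith

theorem indep_bound (F : FreeComplex K n) (hF : IsResolution F) (hcyc : F.rk 0 = 1)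
    (hdeg0 : ∀ p : Fin (F.rk 0), F.deg 0 p = 0) (c : ℕ) (hpd : polyDim (hilbPoly F) = n - c)
    (r : ℕ) (g : Fin r → Fin n) (hg : Function.Injective g)
    (hind : ∀ f : MvPolynomial (Fin r) K, (∃ w : Fin (F.rk 1) → PolyS K n,
      (F.dd 0).mulVec w = fun _ => rename g f) → f = 0) : r ≤ n - c := by
  by_contra hlt
  push Not at hlt
  have hr : r ≠ 0 := by omega
  have hrn : r ≤ n := by simpa using Fintype.card_le_of_injective g hg
  have hn : n ≠ 0 := by omega
  have hd := hilb_degree F c hpd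
  obtain ⟨D, hD⟩ := deg_bound F
  apply poly_contra (hilbPoly F) r hr (hd.trans_le (by exact_mod_cast (by omega)))
    (hd.trans_le (by exact_mod_cast (by omega))) (max D 0)
  intro ℓ hℓ
  have hℓ0 : 0 ≤ ℓ := (le_max_right _ _).trans hℓ
  have hℓD : D ≤ ℓ := (le_max_left _ _).trans hℓ
  rw [← strand_euler F hF hn ℓ (fun i p => (hD i p).trans hℓD), ← multichoose_eval hr 0 ℓ hℓ0, sub_zero]
  let T : homogeneousSubmodule (Fin r) K ℓ.toNat →ₗ[K] freePiece (K := K) (n := n) (F.deg 0) ℓ :=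
    { toFun := fun f => ⟨fun _ => rename g f.1, by
        simp only [freePiece, Submodule.mem_pi, Set.mem_univ, true_implies]
        intro p
        rw [hdeg0, sub_zero, homogZ_of_nonneg hℓ0]
        exact IsHomogeneous.rename_isHomogeneous f.2⟩
      map_add' := fun f f' => by ext1; funext p; simp
      map_smul' := fun a f => by ext1; funext p; simp }
  have hp : Nonempty (Fin (F.rk 0)) := by rw [hcyc]; infer_instance
  have hTinj : Function.Injective T := by
    intro f f' h
    have := congrFun (congrArg Subtype.val h) hp.some
    exact Subtype.ext (rename_injective g hg this)
  haveI := finite_homog (K := K) (Fin r) ℓ.toNat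
  have hdis : Disjoint (LinearMap.range T) (LinearMap.range (sd F ℓ 0)) := by
    rw [Submodule.disjoint_def]
    rintro _ ⟨f, rfl⟩ ⟨w, hw⟩
    have := hind f.1 ⟨w.1, congrArg Subtype.val hw⟩
    rw [show f = 0 from Subtype.ext this, map_zero]
  have h1 := Submodule.finrank_add_finrank_le_of_disjoint hdis
  rw [LinearMap.finrank_range_of_inj hTinj, finrank_homog, Fintype.card_fin] at h1
  have h2 : ((Nat.multichoose r ℓ.toNat : ℕ) : ℚ) + finrank K (LinearMap.range (sd F ℓ 0)) ≤ finrank K (freePiece (K := K) (n := n) (F.deg 0) ℓ) := by exact_mod_cast h1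
  linarith

end hilb2
end MC

namespace MC
section hk

theorem kill_low (Φ : Polynomial ℚ →ₗ[ℚ] ℚ) (c : ℕ)
    (h : ∀ j < c, ∃ h : Polynomial ℚ, h ≠ 0 ∧ h.natDegree = j ∧ Φ h = 0) :
    ∀ f : Polynomial ℚ, f.degree < c → Φ f = 0 := by
  have key : ∀ m : ℕ, m ≤ c → ∀ f : Polynomial ℚ, f.degree < m → Φ f = 0 := by
    intro m
    induction m with
    | zero =>
      intro _ f hf
      have : f = 0 := by
        rw [← Polynomial.degree_eq_bot]
        exact (Nat.WithBot.lt_zero_iff).mp (by simpa using hf)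
      rw [this, map_zero]
    | succ m ih =>
      intro hm f hf
      by_cases hfm : f.degree < m
      · exact ih (by omega) f hfm
      have hfd : f.degree = m := by
        apply le_antisymm
        · exact Polynomial.natDegree_le_iff_degree_le.mp (by
            have := (Polynomial.natDegree_lt_iff_degree_lt (by rintro rfl; exact hfm (by rw [Polynomial.degree_zero]; exact WithBot.bot_lt_coe _))).mpr hf
            omega)
        · exact not_lt.mp hfm
      have hf0 : f ≠ 0 := by rintro rfl; simp at hfd
      obtain ⟨g, hg0, hgd, hg⟩ := h m (by omega)
      have hgd' : g.degree = m := by rw [Polynomial.degree_eq_natDegree hg0, hgd]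
      have hlg : g.leadingCoeff ≠ 0 := Polynomial.leadingCoeff_ne_zero.mpr hg0
      set a := f.leadingCoeff / g.leadingCoeff with ha
      have ha0 : a ≠ 0 := div_ne_zero (Polynomial.leadingCoeff_ne_zero.mpr hf0) hlg
      have h1 : (f - Polynomial.C a * g).degree < m := by
        rw [← hfd]
        apply Polynomial.degree_sub_lt
        · rw [Polynomial.degree_C_mul ha0, hfd, hgd']
        · exact hf0
        · rw [Polynomial.leadingCoeff_mul, Polynomial.leadingCoeff_C, ha]; field_simp
      have h2 := ih (by omega) _ h1
      rw [map_sub, ← Polynomial.smul_eq_C_mul, map_smul, hg, smul_zero, sub_zero] at h2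
      exact h2
  exact key c le_rfl

theorem iter_deriv_degree (p : Polynomial ℚ) (hp : p ≠ 0) (m : ℕ) (hm : m ≤ p.natDegree) :
    Polynomial.derivative^[m] p ≠ 0 ∧ (Polynomial.derivative^[m] p).natDegree = p.natDegree - m := by
  induction m with
  | zero => simpa using hp
  | succ m ih =>
    obtain ⟨h1, h2⟩ := ih (by omega)
    rw [Function.iterate_succ_apply']
    have hd : 0 < (Polynomial.derivative^[m] p).natDegree := by omega
    have h3 := Polynomial.degree_derivative_eq _ hd
    constructor
    · intro h0; rw [h0] at h3; simp at h3
    · rw [Polynomial.natDegree_eq_of_degree_eq_some h3]; omega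

/-- alternating sums over the generators -/
def altsum (F : FreeComplex K n) : Polynomial ℚ →ₗ[ℚ] ℚ :=
  ∑ i ∈ Finset.range (F.len + 1), (-1 : ℚ) ^ i • ∑ p : Fin (F.rk i), Polynomial.leval (-(F.deg i p : ℚ))

theorem altsum_apply (F : FreeComplex K n) (f : Polynomial ℚ) :
    altsum F f = ∑ i ∈ Finset.range (F.len + 1), (-1 : ℚ) ^ i * ∑ p : Fin (F.rk i), f.eval (-(F.deg i p : ℚ)) := by
  simp [altsum, LinearMap.sum_apply]

theorem iter_deriv_comp (f : Polynomial ℚ) (a : ℚ) (m : ℕ) :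
    Polynomial.derivative^[m] (f.comp (Polynomial.X - Polynomial.C a)) =
      (Polynomial.derivative^[m] f).comp (Polynomial.X - Polynomial.C a) := by
  induction m generalizing f with
  | zero => rfl
  | succ m ih =>
    rw [Function.iterate_succ_apply, Polynomial.derivative_comp, Function.iterate_succ_apply, ← ih]
    simp

theorem hk (F : FreeComplex K n) (c : ℕ) (hcn : c ≤ n) (hpd : polyDim (hilbPoly F) = n - c) :
    ∀ f : Polynomial ℚ, f.degree < c → altsum F f = 0 := by
  apply kill_low
  intro j hj
  have hn : n ≠ 0 := by omega
  obtain ⟨h1, h2⟩ := iter_deriv_degree (gp n) (gp_monic n).ne_zero (n - 1 - j) (by rw [gp_natDegree]; omega)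
  refine ⟨_, h1, by rw [h2, gp_natDegree]; omega, ?_⟩
  have h3 : Polynomial.derivative^[n - 1 - j] (hilbPoly F) = 0 := by
    rw [polyDim] at hpd
    split_ifs at hpd with h0
    · rw [h0]; simp
    · exact Polynomial.iterate_derivative_eq_zero (by omega)
  have h4 := congrArg (Polynomial.eval 0) h3
  rw [hilbPoly, Polynomial.iterate_derivative_sum, Polynomial.eval_finsetSum] at h4
  rw [Polynomial.eval_zero] at h4
  have hfac : (((n - 1).factorial : ℚ))⁻¹ ≠ 0 := by positivity
  apply (mul_eq_zero.mp (Eq.trans _ h4)).resolve_left hfac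
  rw [altsum_apply, Finset.mul_sum]
  refine Finset.sum_congr rfl fun i _ => ?_
  rw [Polynomial.iterate_derivative_C_mul, Polynomial.iterate_derivative_sum, Polynomial.eval_mul,
    Polynomial.eval_C, Polynomial.eval_finsetSum, mul_left_comm]
  congr 1
  rw [Finset.mul_sum]
  refine Finset.sum_congr rfl fun p _ => ?_
  rw [genHilb_eq hn, Polynomial.iterate_derivative_C_mul, iter_deriv_comp]
  simp

theorem hk_mult (F : FreeComplex K n) (c : ℕ) (hcn : c ≤ n) (hpd : polyDim (hilbPoly F) = n - c) (B : ℤ) :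
    ∑ i ∈ Finset.range (F.len + 1), (-1 : ℚ) ^ i * ∑ p : Fin (F.rk i), ((B : ℚ) - F.deg i p) ^ c =
      c.factorial * multQ F c := by
  have h1 := hk F c hcn hpd ((Polynomial.X + Polynomial.C (B : ℚ)) ^ c - Polynomial.X ^ c) (by
    by_cases hc : c = 0
    · subst hc; simp
    rw [← Polynomial.degree_X_pow (R := ℚ) c]
    have : ((Polynomial.X : Polynomial ℚ) ^ c).degree = ((Polynomial.X + Polynomial.C (B : ℚ)) ^ c).degree := by
      rw [Polynomial.degree_pow, Polynomial.degree_pow, Polynomial.degree_X_add_C, Polynomial.degree_X]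
    rw [this]
    apply Polynomial.degree_sub_lt this.symm
    · exact pow_ne_zero _ (Polynomial.X_add_C_ne_zero _)
    · rw [Polynomial.leadingCoeff_pow, Polynomial.leadingCoeff_pow, Polynomial.leadingCoeff_X_add_C,
        Polynomial.leadingCoeff_X])
  rw [map_sub, sub_eq_zero, altsum_apply, altsum_apply] at h1
  have e1 : ∀ i (p : Fin (F.rk i)), ((Polynomial.X + Polynomial.C (B : ℚ)) ^ c).eval (-(F.deg i p : ℚ)) = ((B : ℚ) - F.deg i p) ^ c := by
    intro i p; simp; ring
  simp only [e1] at h1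
  rw [h1, multQ]
  have hfac : ((c.factorial : ℚ)) ≠ 0 := by positivity
  rw [← mul_assoc, mul_div_cancel₀ _ hfac, Finset.mul_sum]
  refine Finset.sum_congr rfl fun i _ => ?_
  rw [mul_left_comm]
  congr 1
  rw [Finset.mul_sum]
  refine Finset.sum_congr rfl fun p _ => ?_
  rw [Polynomial.eval_pow, Polynomial.eval_X, neg_pow]

end hk
end MC

namespace MC

/-! ### Generic linear sections -/

theorem rk_point (F : FreeComplex K n) (hF : IsResolution F) (hcyc : F.rk 0 = 1)
    (hdeg0 : ∀ p : Fin (F.rk 0), F.deg 0 p = 0) (c : ℕ) (hpd : polyDim (hilbPoly F) = n - c)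
    {L : Type} [Field L] [Algebra K L] (w : Fin n → L)
    (hw : ∀ p q, aeval w (F.dd 0 p q) = 0) :
    (AlgebraicIndependent.matroid K L).eRk (Set.range w) ≤ ((n - c : ℕ) : ℕ∞) := by
  rw [Matroid.eRk_le_iff]
  intro I hI hind
  obtain ⟨J, hJ, hinj⟩ : ∃ J : Set (Fin n), Set.image w J = I ∧ Set.InjOn w J := by
    obtain ⟨J, -, h1⟩ := (Set.SurjOn.exists_bijOn_subset (s := Set.univ) (t := I) (f := w)
      (fun x hx => by obtain ⟨i, rfl⟩ := hI hx; exact ⟨i, trivial, rfl⟩))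
    exact ⟨J, h1.image_eq, h1.injOn⟩
  classical
  set J' : Finset (Fin n) := J.toFinset with hJ'
  let g : Fin J'.card ↪o Fin n := J'.orderEmbOfFin rfl
  have hgJ : ∀ i, g i ∈ J := fun i => by
    exact Set.mem_toFinset.1 (J'.orderEmbOfFin_mem rfl i)
  have hind' : AlgebraicIndependent K (fun i => w (g i)) := by
    rw [AlgebraicIndependent.matroid_indep_iff] at hind
    have h2 : AlgebraicIndependent K (fun x : I => (x : L)) := hind
    exact h2.comp (fun i => (⟨w (g i), hJ ▸ ⟨g i, hgJ i, rfl⟩⟩ : I)) (fun a b hab => by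
      simp only [Subtype.mk.injEq] at hab
      exact g.injective (hinj (hgJ a) (hgJ b) hab))
  have hle := indep_bound F hF hcyc hdeg0 c hpd J'.card g g.injective (by
    rintro f ⟨w', hw'⟩
    have p0 : Fin (F.rk 0) := ⟨0, by omega⟩
    have h3 := congrFun hw' p0
    have h4 := congrArg (aeval w) h3
    rw [aeval_rename] at h4
    simp only [Matrix.mulVec, dotProduct, map_sum, map_mul, hw, zero_mul, Finset.sum_const_zero] at h4
    exact (injective_iff_map_eq_zero _).1 hind' f h4.symm)
  rw [← hJ, hinj.encard_image, ← Set.coe_toFinset J, Set.encard_coe_eq_coe_finsetCard]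
  exact_mod_cast hle

theorem no_point (F : FreeComplex K n) (hF : IsResolution F) (hcyc : F.rk 0 = 1)
    (hdeg0 : ∀ p : Fin (F.rk 0), F.deg 0 p = 0) (c : ℕ) (hcn : c ≤ n)
    (hpd : polyDim (hilbPoly F) = n - c)
    {L : Type} [Field L] [Algebra K L] (u : Fin n × Fin c → L) (hu : AlgebraicIndependent K u)
    (v : Fin c → L) (hv : ∀ p q, aeval (fun i => ∑ j, u (i, j) * v j) (F.dd 0 p q) = 0) : v = 0 := by
  by_contra hne
  obtain ⟨j0, hj0⟩ : ∃ j, v j ≠ 0 := by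
    by_contra h; push Not at h; exact hne (funext h)
  have hc : 0 < c := j0.pos
  set v' : Fin c → L := fun j => (v j0)⁻¹ * v j with hv'
  set w : Fin n → L := fun i => ∑ j, u (i, j) * v' j with hw
  have hz : ∀ p q, aeval w (F.dd 0 p q) = 0 := by
    intro p q
    have h1 := F.isHomog 0 p q
    rw [mem_homogZ] at h1
    rcases h1 with ⟨_, h1⟩ | h1
    · have h2 : w = fun i => (v j0)⁻¹ * ∑ j, u (i, j) * v j := by
        funext i; rw [hw, Finset.mul_sum]
        exact Finset.sum_congr rfl fun j _ => by rw [hv']; ring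
      rw [h2]
      have h3 := hv p q
      rw [aeval_def, eval₂_eq'] at h3 ⊢
      have h4 : ∀ d ∈ (F.dd 0 p q).support, (algebraMap K L) (coeff d (F.dd 0 p q)) *
          ∏ i, ((v j0)⁻¹ * ∑ j, u (i, j) * v j) ^ d i = ((v j0)⁻¹) ^ (F.deg (0+1) q - F.deg 0 p).toNat *
          ((algebraMap K L) (coeff d (F.dd 0 p q)) * ∏ i, (∑ j, u (i, j) * v j) ^ d i) := by
        intro d hd
        have h5 : d.degree = (F.deg (0+1) q - F.deg 0 p).toNat := by
          rw [← h1 (mem_support_iff.1 hd), Finsupp.degree_eq_weight_one]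
          rfl
        have h6 : ∑ i, d i = (F.deg (0+1) q - F.deg 0 p).toNat := by
          rw [← h5, Finsupp.degree_eq_sum]
        simp only [mul_pow, Finset.prod_mul_distrib]
        rw [Finset.prod_pow_eq_pow_sum, h6]
        ring
      rw [Finset.sum_congr rfl h4, ← Finset.mul_sum, h3, mul_zero]
    · rw [h1, map_zero]
  have hwr := rk_point F hF hcyc hdeg0 c hpd w hz
  set M := AlgebraicIndependent.matroid K L with hM
  set T : Set L := (Set.range w ∪ (Set.image u {x | x.2 ≠ j0})) ∪ Set.image v' {j | j ≠ j0} with hT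
  have hTrk : M.eRk T ≤ ((n - c : ℕ) : ℕ∞) + ((n * (c-1) : ℕ) : ℕ∞) + ((c - 1 : ℕ) : ℕ∞) := by
    refine (M.eRk_union_le_eRk_add_encard _ _).trans (add_le_add ((M.eRk_union_le_eRk_add_encard _ _).trans (add_le_add hwr ?_)) ?_)
    · refine (Set.encard_image_le _ _).trans ?_
      have : {x : Fin n × Fin c | x.2 ≠ j0} = ((Finset.univ ×ˢ Finset.univ.erase j0 : Finset (Fin n × Fin c)) : Set _) := by
        ext x; simp
      rw [this, Set.encard_coe_eq_coe_finsetCard, Finset.card_product, Finset.card_erase_of_mem (Finset.mem_univ _)]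
      simp
    · refine (Set.encard_image_le _ _).trans ?_
      have : {x : Fin c | x ≠ j0} = ((Finset.univ.erase j0 : Finset (Fin c)) : Set _) := by
        ext x; simp
      rw [this, Set.encard_coe_eq_coe_finsetCard, Finset.card_erase_of_mem (Finset.mem_univ _)]
      simp
  have hsub : T ⊆ M.closure T := M.subset_closure T (by rw [hM, AlgebraicIndependent.matroid_e]; exact Set.subset_univ _)
  have hcl : Set.range u ⊆ M.closure T := by
    have hcle : M.closure T = (Subalgebra.algebraicClosure (Algebra.adjoin K T) L : Set L) :=
      AlgebraicIndependent.matroid_closure_eq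
    rw [hcle] at hsub ⊢
    have hu0 : ∀ i j, j ≠ j0 → u (i,j) ∈ Subalgebra.algebraicClosure (Algebra.adjoin K T) L := fun i j hj =>
      hsub (Or.inl (Or.inr ⟨(i,j), hj, rfl⟩))
    rintro _ ⟨⟨i, j⟩, rfl⟩
    by_cases hj : j = j0
    · subst hj
      have h5 : u (i, j) = w i - ∑ l ∈ Finset.univ.erase j, u (i, l) * v' l := by
        rw [hw]
        simp only
        rw [← Finset.add_sum_erase _ _ (Finset.mem_univ j)]
        have : v' j = 1 := inv_mul_cancel₀ hj0
        rw [this]; ring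
      rw [h5]
      refine sub_mem (hsub (Or.inl (Or.inl ⟨i, rfl⟩))) (sum_mem fun l hl => mul_mem ?_ ?_)
      · exact hu0 i l (Finset.ne_of_mem_erase hl)
      · exact hsub (Or.inr ⟨l, Finset.ne_of_mem_erase hl, rfl⟩)
    · exact hu0 i j hj
  have hui : M.Indep (Set.range u) := by
    rw [hM, AlgebraicIndependent.matroid_indep_iff]
    exact AlgebraicIndependent.coe_range hu
  have hfin := hui.encard_le_eRk_of_subset hcl
  rw [M.eRk_closure_eq] at hfin
  have hcard : (Set.range u).encard = ((n * c : ℕ) : ℕ∞) := by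
    rw [← Set.image_univ, hu.injective.injOn.encard_image]
    simp [Set.encard_univ]
  rw [hcard] at hfin
  have h8 := hfin.trans hTrk
  have h9 : n * c ≤ (n - c) + n * (c - 1) + (c - 1) := by exact_mod_cast h8
  obtain ⟨e, rfl⟩ : ∃ e, c = e + 1 := ⟨c - 1, by omega⟩
  simp only [Nat.add_sub_cancel] at h9
  rw [Nat.mul_succ] at h9
  omega

/-- The generic matrix exists, over an algebraically closed field. -/
theorem generic_exists (K : Type) [Field K] (n c : ℕ) : ∃ (L : Type) (_ : Field L) (_ : Algebra K L),
    IsAlgClosed L ∧ ∃ u : Fin n × Fin c → L, AlgebraicIndependent K u := by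
  let R := MvPolynomial (Fin n × Fin c) K
  let E := FractionRing R
  refine ⟨AlgebraicClosure E, AlgebraicClosure.instField E, AlgebraicClosure.instAlgebra E, inferInstance,
    fun x => algebraMap E _ (algebraMap R E (X x)), ?_⟩
  have h1 : AlgebraicIndependent K (X : Fin n × Fin c → R) := MvPolynomial.algebraicIndependent_X _ _
  have h2 := h1.map' (f := IsScalarTower.toAlgHom K R (AlgebraicClosure E)) (by
    have : Function.Injective (algebraMap R (AlgebraicClosure E)) := by
      rw [IsScalarTower.algebraMap_eq R E]
      exact (algebraMap E (AlgebraicClosure E)).injective.comp (IsFractionRing.injective R E)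
    exact this)
  exact h2

/-- the generic substitution -/
def psi {L : Type} [Field L] [Algebra K L] {c : ℕ} (u : Fin n × Fin c → L) (z : Fin c → MvPolynomial (Fin c) L) :
    PolyS K n →ₐ[K] MvPolynomial (Fin c) L := aeval fun i => ∑ j, C (u (i, j)) * z j

theorem psi_X {L : Type} [Field L] [Algebra K L] {c : ℕ} (u : Fin n × Fin c → L)
    (z : Fin c → MvPolynomial (Fin c) L) (i : Fin n) : psi (K := K) u z (X i) = ∑ j, C (u (i, j)) * z j := by
  rw [psi, aeval_X]

theorem psi_C {L : Type} [Field L] [Algebra K L] {c : ℕ} (u : Fin n × Fin c → L)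
    (z : Fin c → MvPolynomial (Fin c) L) (a : K) : psi u z (C a) = C (algebraMap K L a) := by
  rw [psi, aeval_C]; rfl

theorem psi_comp {L : Type} [Field L] [Algebra K L] {c : ℕ} (u : Fin n × Fin c → L)
    (z : Fin c → MvPolynomial (Fin c) L) (f : PolyS K n) : aeval z (psi u X f) = psi u z f := by
  induction f using MvPolynomial.induction_on with
  | C a => rw [psi_C, psi_C, aeval_C]; rfl
  | add f g hf hg => rw [map_add, map_add, map_add, hf, hg]
  | mul_X f i hf =>
    rw [map_mul, map_mul, map_mul, hf, psi_X, psi_X, map_sum]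
    congr 1
    refine Finset.sum_congr rfl fun j _ => ?_
    rw [map_mul, aeval_X, aeval_C]; rfl

theorem psi_aeval {L : Type} [Field L] [Algebra K L] {c : ℕ} (u : Fin n × Fin c → L)
    (z : Fin c → MvPolynomial (Fin c) L) (x : Fin c → L) (f : PolyS K n) :
    aeval x (psi u z f) = aeval (fun i => ∑ j, u (i, j) * aeval x (z j)) f := by
  induction f using MvPolynomial.induction_on with
  | C a => rw [psi_C, aeval_C, aeval_C]; rfl
  | add f g hf hg => rw [map_add, map_add, map_add, hf, hg]
  | mul_X f i hf =>
    rw [map_mul, map_mul, map_mul, hf, psi_X, aeval_X, map_sum]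
    congr 1
    refine Finset.sum_congr rfl fun j _ => ?_
    rw [map_mul, aeval_C]; rfl

theorem nullst (F : FreeComplex K n) (hF : IsResolution F) (hcyc : F.rk 0 = 1)
    (hdeg0 : ∀ p : Fin (F.rk 0), F.deg 0 p = 0) (c : ℕ) (hcn : c ≤ n)
    (hpd : polyDim (hilbPoly F) = n - c)
    {L : Type} [Field L] [IsAlgClosed L] [Algebra K L] (u : Fin n × Fin c → L) (hu : AlgebraicIndependent K u) :
    ∃ r : ℕ, ∀ z : Fin c → MvPolynomial (Fin c) L, ∀ j,
      NullH (fun i => (F.dd i).map (psi u z)) (z j ^ r) := by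
  set s : Set (MvPolynomial (Fin c) L) := {y | ∃ p q, y = psi u X (F.dd 0 p q)} with hs
  have h1 : ∀ j, X j ∈ (Ideal.span s).radical := by
    intro j
    rw [← vanishingIdeal_zeroLocus_eq_radical (K := L)]
    intro x hx
    have : x = 0 := no_point F hF hcyc hdeg0 c hcn hpd u hu x (by
      intro p q
      have := hx _ (Ideal.subset_span ⟨p, q, rfl⟩)
      rw [← this]
      rw [psi_aeval]; simp only [aeval_X])
    simp [this]
  have h2 : ∀ j, ∃ r, (X j : MvPolynomial (Fin c) L) ^ r ∈ Ideal.span s := h1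
  choose r hr using h2
  refine ⟨∑ j, r j, fun z j => ?_⟩
  have h3 : (X j : MvPolynomial (Fin c) L) ^ (∑ j, r j) ∈ Ideal.span s :=
    Ideal.pow_mem_of_pow_mem _ (hr j) (Finset.single_le_sum (fun _ _ => Nat.zero_le _) (Finset.mem_univ j))
  have h4 : NullH (fun i => (F.dd i).map (psi u X).toRingHom) ((X j : MvPolynomial (Fin c) L) ^ (∑ j, r j)) := by
    refine NullH.span ?_ h3
    rintro y ⟨p, q, rfl⟩
    exact NullH.map (psi (K := K) u X).toRingHom (nullH_gen F hF hcyc p q)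
  have h5 := NullH.map (aeval z : MvPolynomial (Fin c) L →ₐ[L] MvPolynomial (Fin c) L).toRingHom h4
  have h6 : (fun i => ((F.dd i).map (psi u X).toRingHom).map
      (aeval z : MvPolynomial (Fin c) L →ₐ[L] MvPolynomial (Fin c) L).toRingHom) =
      fun i => (F.dd i).map (psi u z) := by
    funext i
    ext1 p q
    exact psi_comp u z _
  rw [h6] at h5
  have h7 : z j ^ (∑ j, r j) =
      (aeval z : MvPolynomial (Fin c) L →ₐ[L] MvPolynomial (Fin c) L).toRingHom (X j ^ (∑ j, r j)) := by
    rw [map_pow]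
    congr 1
    exact (aeval_X z j).symm
  rw [h7]
  exact h5

end MC

namespace MC

/-! ### Consequences of minimality -/

theorem smul_empty {k : Type} [Field k] {c : ℕ} (f : MvPolynomial (Fin c) k) (v : VA k c ∅) :
    ofV (f • v) = f * ofV v := by
  induction f using MvPolynomial.induction_on generalizing v with
  | C a => rw [smul_C_VA, C_mul']
  | add f g hf hg => rw [add_smul, map_add, hf, hg, add_mul]
  | mul_X f i hf => rw [mul_smul, hf, smul_X_of_notMem (by simp), mul_assoc]

theorem act_empty {k : Type} [Field k] {c a b : ℕ} (M : Matrix (Fin a) (Fin b) (MvPolynomial (Fin c) k))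
    (v : Fin b → VA k c ∅) (p : Fin a) : ofV (act _ M v p) = M.mulVec (fun q => ofV (v q)) p := by
  rw [act_apply, map_sum, Matrix.mulVec, dotProduct]
  exact Finset.sum_congr rfl fun q _ => smul_empty _ _

theorem Ex_res (F : FreeComplex K n) (hF : IsResolution F) (i : ℕ) :
    Ex (F.dd (i+1)) (F.dd i) (⊥ : Submodule _ (VA K n ∅)) := by
  intro x hx
  have h1 : (fun q => ofV (x q)) ∈ LinearMap.ker (F.dd i).mulVecLin := by
    rw [LinearMap.mem_ker]
    funext p
    rw [Matrix.mulVecLin_apply, ← act_empty]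
    rw [mem_tup] at hx
    have := hx p
    rw [Submodule.mem_bot] at this
    rw [this]; simp
  rw [hF i] at h1
  obtain ⟨w, hw⟩ := h1
  refine ⟨fun q => ofV.symm (w q), mem_tup.mpr fun p => ?_⟩
  rw [Submodule.mem_bot]
  apply ofV.injective
  rw [Pi.sub_apply, map_sub, act_empty, map_zero]
  have := congrFun hw p
  rw [Matrix.mulVecLin_apply] at this
  simp only [AddEquiv.apply_symm_apply]
  rw [this, sub_self]

theorem const_zero (F : FreeComplex K n) (hmin : IsMinimal F) (i : ℕ) (p q) :
    constantCoeff (F.dd i p q) = 0 := by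
  have h := F.isHomog i p q
  rw [mem_homogZ] at h
  rcases h with ⟨h0, h⟩ | h
  · by_cases hz : F.deg (i+1) q = F.deg i p
    · rw [hmin i p q hz, map_zero]
    · rw [constantCoeff_eq]
      by_contra hne
      have := h hne
      rw [map_zero] at this
      omega
  · rw [h, map_zero]

theorem deg_lt (F : FreeComplex K n) (hmin : IsMinimal F) (i : ℕ) (p q) (h0 : F.dd i p q ≠ 0) :
    F.deg i p < F.deg (i+1) q := by
  have h := F.isHomog i p q
  rw [mem_homogZ] at h
  rcases h with ⟨h1, h⟩ | h
  · rcases lt_or_eq_of_le h1 with h2 | h2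
    · omega
    · exact (h0 (hmin i p q (by omega))).elim
  · exact (h0 h).elim

theorem col_ne (F : FreeComplex K n) (hF : IsResolution F) (hmin : IsMinimal F) (i : ℕ)
    (q : Fin (F.rk (i+1))) : ∃ p, F.dd i p q ≠ 0 := by
  by_contra hcon
  push Not at hcon
  have h1 : (Pi.single q 1 : Fin (F.rk (i+1)) → PolyS K n) ∈ LinearMap.ker (F.dd i).mulVecLin := by
    rw [LinearMap.mem_ker, Matrix.mulVecLin_apply, Matrix.mulVec_single_one]
    funext p
    exact hcon p
  rw [hF i] at h1
  obtain ⟨w, hw⟩ := h1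
  have h2 := congrArg constantCoeff (congrFun hw q)
  rw [Matrix.mulVecLin_apply, Matrix.mulVec, dotProduct, map_sum] at h2
  simp [const_zero F hmin] at h2

theorem c_le_n (F : FreeComplex K n) (hF : IsResolution F) (hmin : IsMinimal F) (c : ℕ)
    (hrk : ∀ i, c < i → F.rk i = 0) (hc : F.rk c ≠ 0) : c ≤ n := by
  by_contra hlt
  push Not at hlt
  obtain ⟨i, rfl⟩ : ∃ i, c = i + 1 := ⟨c - 1, by omega⟩
  have h1 := syz F.dd F.isComplex (Ex_res F hF) Finset.univ i (by simp; omega)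
  let q : Fin (F.rk (i+1)) := ⟨0, by omega⟩
  obtain ⟨y, hy⟩ := h1 (fun p => ofV.symm (if p = q then 1 else 0)) (by
    rw [mem_tup]; intro p
    apply mem_of_theta (by simp)
    rw [act_empty]
    simp only [AddEquiv.apply_symm_apply, Matrix.mulVec, dotProduct, mul_ite, mul_one, mul_zero,
      Finset.sum_ite_eq', Finset.mem_univ, if_true]
    have h2 : ∀ f : MvPolynomial (Fin n) K, theta Finset.univ 0 f = C (constantCoeff f) := by
      intro f
      simp only [theta, Finset.mem_univ, if_true, Pi.zero_apply, C_0]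
      rw [show (fun _ : Fin n => (0 : MvPolynomial (Fin n) K)) = 0 from rfl, aeval_zero]
      rfl
    rw [h2, const_zero F hmin, C_0])
  rw [mem_tup] at hy
  have h3 := theta_of_mem (by simp) _ _ (hy q)
  have h4 : act (VA K n ∅) (F.dd (i+1)) y q = 0 := by
    rw [act_apply]
    apply Finset.sum_eq_zero
    intro x _
    have := hrk (i+1+1) (by omega)
    exact (Fin.elim0 (this ▸ x))
  rw [Pi.sub_apply, h4, sub_zero] at h3
  simp at h3

theorem psi_zero {L : Type} [Field L] [Algebra K L] {c : ℕ} (f : PolyS K n) :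
    aeval (fun _ => (0 : L)) f = algebraMap K L (constantCoeff f) := by
  exact aeval_zero' _

theorem exists_lam (L : Type) [Field L] [Infinite L] (c : ℕ) : ∃ lam : Fin c → Fin c → L,
    ∀ l, Function.Injective fun j => lam j l :=
  ⟨fun j _ => Infinite.natEmbedding L j, fun _ a b h => Fin.ext ((Infinite.natEmbedding L).injective h)⟩

theorem map_complex (F : FreeComplex K n) {R : Type} [CommRing R] [Algebra K R] (f : PolyS K n →ₐ[K] R) (i : ℕ) :
    (F.dd i).map f * (F.dd (i+1)).map f = 0 := by
  rw [← Matrix.map_mul, F.isComplex]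
  exact Matrix.map_zero _ (map_zero f)

theorem row_ne (F : FreeComplex K n) (hmin : IsMinimal F) (c : ℕ)
    {L : Type} [Field L] [Algebra K L] (u : Fin n × Fin c → L)
    {lam : Fin c → Fin c → L} (hlam : ∀ l, Function.Injective fun j => lam j l) (r : ℕ)
    (hN : ∀ j, NullH (fun i => (F.dd i).map (psi u (ZZ ∅ lam))) (ZZ ∅ lam j ^ r))
    (i : ℕ) (hi : i + 1 < c) (p : Fin (F.rk (i+1))) : ∃ q, F.dd (i+1) p q ≠ 0 := by
  by_contra hcon
  push Not at hcon
  have h1 := (acyc_dual hlam (fun i => (F.dd i).map (psi u (ZZ ∅ lam)))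
    (map_complex F _) r hN c 0 (by simp) ∅ (by simp) 0 (by simp)).1 i (by omega)
  obtain ⟨y, hy⟩ := h1 (fun p' => ofV.symm (if p' = p then 1 else 0)) (by
    rw [mem_tup]; intro q
    apply mem_of_theta (by simp)
    rw [act_empty]
    simp only [AddEquiv.apply_symm_apply, Matrix.mulVec, dotProduct, mul_ite, mul_one, mul_zero,
      Finset.sum_ite_eq', Finset.mem_univ, if_true, Matrix.transpose_apply, Matrix.map_apply]
    rw [hcon, map_zero, map_zero])
  rw [mem_tup] at hy
  have h3 := theta_of_mem (by simp) _ _ (hy p)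
  have h2 : ∀ f : MvPolynomial (Fin c) L, theta ∅ 0 f = f := by
    intro f
    simp only [theta, Finset.notMem_empty, if_false]
    exact aeval_X_left_apply f
  rw [h2, Pi.sub_apply, map_sub, act_empty] at h3
  have h4 := congrArg (aeval (fun l => lam l l)) h3
  have h5 : ∀ j, aeval (fun l => lam l l) (ZZ ∅ lam j) = 0 := by
    intro j
    rw [ZZ, map_prod]
    apply Finset.prod_eq_zero (Finset.mem_univ j)
    simp [fac]
  rw [map_sub, Matrix.mulVec, dotProduct, map_sum] at h4
  rw [Finset.sum_eq_zero] at h4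
  · simp at h4
  · intro q _
    rw [map_mul, Matrix.transpose_apply, Matrix.map_apply, psi_aeval]
    simp only [h5, mul_zero, Finset.sum_const_zero]
    rw [psi_zero (c := c), const_zero F hmin, map_zero, zero_mul]

end MC

namespace MC

/-! ### The double complex -/

section compat
variable {k : Type} [Field k] {c : ℕ}

/-- compatibility of the actions with the restriction maps -/
def QQ (A : Finset (Fin c)) (l : Fin c) (g' g : MvPolynomial (Fin c) k) (e : ℤ) : Prop :=
  ∀ (s : ℤ) (v : MvPolynomial (Fin c) k),
    rho (insert l A) g' (sh l (-s) v) = sh l (-(s + e)) (rho A g v)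

theorem QQ.mul {A : Finset (Fin c)} {l : Fin c} {g' g h' h : MvPolynomial (Fin c) k} {e f : ℤ}
    (H : QQ A l g' g e) (H' : QQ A l h' h f) : QQ A l (g' * h') (g * h) (e + f) := by
  intro s v
  rw [map_mul, map_mul, Module.End.mul_apply, Module.End.mul_apply, H', H]
  congr 2; ring

theorem QQ.add {A : Finset (Fin c)} {l : Fin c} {g' g h' h : MvPolynomial (Fin c) k} {e : ℤ}
    (H : QQ A l g' g e) (H' : QQ A l h' h e) : QQ A l (g' + h') (g + h) e := by
  intro s v
  rw [map_add, map_add, LinearMap.add_apply, LinearMap.add_apply, H', H, map_add]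

theorem QQ.sub {A : Finset (Fin c)} {l : Fin c} {g' g h' h : MvPolynomial (Fin c) k} {e : ℤ}
    (H : QQ A l g' g e) (H' : QQ A l h' h e) : QQ A l (g' - h') (g - h) e := by
  intro s v
  rw [map_sub, map_sub, LinearMap.sub_apply, LinearMap.sub_apply, H', H, map_sub]

theorem QQ.zero (A : Finset (Fin c)) (l : Fin c) (e : ℤ) : QQ A l (0 : MvPolynomial (Fin c) k) 0 e := by
  intro s v
  rw [map_zero, map_zero, LinearMap.zero_apply, LinearMap.zero_apply, map_zero]

theorem QQ.const (A : Finset (Fin c)) (l : Fin c) (a : k) : QQ A l (C a) (C a) 0 := by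
  intro s v
  rw [rho_C, rho_C, map_smul, add_zero]

theorem QQ.one (A : Finset (Fin c)) (l : Fin c) : QQ A l (1 : MvPolynomial (Fin c) k) 1 0 := by
  rw [← C_1]; exact QQ.const A l 1

theorem QQ.var {A : Finset (Fin c)} {l j : Fin c} (h : j ≠ l) :
    QQ A l (X j : MvPolynomial (Fin c) k) (X j) 0 := by
  intro s v
  rw [rho_X, rho_X, add_zero, xop, xop]
  by_cases hj : j ∈ A
  · rw [if_pos hj, if_pos (Finset.mem_insert_of_mem hj), sh_comm h]
  · rw [if_neg hj, if_neg (by simp [h, hj]), sh_comm h]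

theorem QQ.sum {A : Finset (Fin c)} {l : Fin c} {α : Type*} (t : Finset α)
    (g' g : α → MvPolynomial (Fin c) k) {e : ℤ}
    (H : ∀ a ∈ t, QQ A l (g' a) (g a) e) : QQ A l (∑ a ∈ t, g' a) (∑ a ∈ t, g a) e := by
  classical
  induction t using Finset.induction_on with
  | empty => rw [Finset.sum_empty, Finset.sum_empty]; exact QQ.zero A l e
  | insert a t ha ih =>
    rw [Finset.sum_insert ha, Finset.sum_insert ha]
    exact (H a (by simp)).add (ih fun b hb => H b (Finset.mem_insert_of_mem hb))

theorem QQ.prod {A : Finset (Fin c)} {l : Fin c} {α : Type*} (t : Finset α)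
    (g' g : α → MvPolynomial (Fin c) k) (e : α → ℤ)
    (H : ∀ a ∈ t, QQ A l (g' a) (g a) (e a)) :
    QQ A l (∏ a ∈ t, g' a) (∏ a ∈ t, g a) (∑ a ∈ t, e a) := by
  classical
  induction t using Finset.induction_on with
  | empty => rw [Finset.prod_empty, Finset.prod_empty]; exact QQ.one A l
  | insert a t ha ih =>
    rw [Finset.prod_insert ha, Finset.prod_insert ha, Finset.sum_insert ha]
    exact (H a (by simp)).mul (ih fun b hb => H b (Finset.mem_insert_of_mem hb))

theorem QQ.pow {A : Finset (Fin c)} {l : Fin c} {g' g : MvPolynomial (Fin c) k} {e : ℤ}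
    (H : QQ A l g' g e) (m : ℕ) : QQ A l (g' ^ m) (g ^ m) (m * e) := by
  have := QQ.prod (A := A) (l := l) (Finset.range m) (fun _ => g') (fun _ => g) (fun _ => e) (fun _ _ => H)
  simpa using this

theorem QQ.fac_mem {A : Finset (Fin c)} {l : Fin c} (hl : l ∉ A) (lam : Fin c → Fin c → k) (j i : Fin c) :
    QQ A l (fac (insert l A) lam j i) (fac A lam j i) (if i = l then 1 else 0) := by
  by_cases h : i = l
  · subst h
    rw [if_pos rfl, fac, fac, if_neg hl, if_pos (Finset.mem_insert_self _ _)]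
    intro s v
    rw [map_sub, map_sub, map_mul, map_one, LinearMap.sub_apply, LinearMap.sub_apply,
      Module.End.mul_apply, rho_C, rho_C, rho_X, rho_X, xop, xop, if_neg hl,
      if_pos (Finset.mem_insert_self _ _), map_sub, map_smul, Module.End.one_apply,
      sh_sh i (-1) (-s) (Or.inl (by norm_num)), sh_sh i (-(s+1)) 1 (Or.inr (by norm_num))]
    have e1 : -(s+1) + 1 = -s := by ring
    have e2 : -1 + -s = -(s+1) := by ring
    rw [e1, e2]
  · rw [if_neg h, fac, fac]
    by_cases hi : i ∈ A
    · rw [if_pos hi, if_pos (Finset.mem_insert_of_mem hi)]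
      have h1 : QQ A l (C (lam j i) * X i) (C (lam j i) * X i) 0 := by
        have := (QQ.const A l (lam j i)).mul (QQ.var (k := k) (A := A) h)
        rwa [zero_add] at this
      exact (QQ.one (k := k) A l).sub h1
    · rw [if_neg hi, if_neg (by simp [h, hi])]
      exact (QQ.var h).sub (QQ.const A l _)

theorem QQ.zz {A : Finset (Fin c)} {l : Fin c} (hl : l ∉ A) (lam : Fin c → Fin c → k) (j : Fin c) :
    QQ A l (ZZ (insert l A) lam j) (ZZ A lam j) 1 := by
  have := QQ.prod Finset.univ _ _ _ (fun i _ => QQ.fac_mem hl lam j i)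
  rw [Finset.sum_ite_eq' Finset.univ l, if_pos (Finset.mem_univ _)] at this
  exact this

theorem QQ.psi_hom [Algebra K k] (u : Fin n × Fin c → k) {A : Finset (Fin c)} {l : Fin c} (hl : l ∉ A)
    (lam : Fin c → Fin c → k) {e : ℤ} {f : PolyS K n} (hf : f ∈ homogZ K n e) :
    QQ A l (psi u (ZZ (insert l A) lam) f) (psi u (ZZ A lam) f) e := by
  rw [mem_homogZ] at hf
  rcases hf with ⟨h0, hf⟩ | hf
  swap
  · rw [hf, map_zero, map_zero]; exact QQ.zero A l e
  have hX : ∀ i, QQ A l (psi (K := K) u (ZZ (insert l A) lam) (X i))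
      (psi (K := K) u (ZZ A lam) (X i)) 1 := by
    intro i
    rw [psi_X, psi_X]
    refine QQ.sum _ _ _ fun j _ => ?_
    have := (QQ.const A l (u (i, j))).mul (QQ.zz hl lam j)
    rwa [zero_add] at this
  rw [f.as_sum, map_sum, map_sum]
  refine QQ.sum _ _ _ fun d hd => ?_
  have hde : ∑ i, ((d i : ℤ) * 1) = e := by
    have h5 := hf (mem_support_iff.1 hd)
    rw [Pi.one_def, ← Finsupp.degree_eq_weight_one] at h5
    have h6 : ∑ i, d i = e.toNat := by
      rw [← h5, ← Finsupp.degree_eq_sum]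
    have h7 : ((∑ i, d i : ℕ) : ℤ) = e := by rw [h6]; omega
    rw [← h7]; simp
  rw [monomial_eq, Finsupp.prod_fintype _ _ (by simp), map_mul, map_mul, psi_C, psi_C, map_prod, map_prod,
    ← zero_add e, ← hde]
  refine (QQ.const A l _).mul (QQ.prod _ _ _ _ fun i _ => ?_)
  rw [map_pow, map_pow]
  exact (hX i).pow _

end compat

section dbl
variable (F : FreeComplex K n) {c : ℕ} {L : Type} [Field L] [Algebra K L] (u : Fin n × Fin c → L)
  (lam : Fin c → Fin c → L) (B : Fin c → ℤ)

/-- the matrices in the chart `A` -/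
def Mat (A : Finset (Fin c)) (i : ℕ) : Matrix (Fin (F.rk i)) (Fin (F.rk (i+1))) (MvPolynomial (Fin c) L) :=
  (F.dd i).map (psi u (ZZ A lam))

/-- terms of the double complex -/
abbrev DD (F : FreeComplex K n) (c : ℕ) (L : Type) [Field L] (i : ℕ) : Type :=
  Fin (F.rk i) → Finset (Fin c) → MvPolynomial (Fin c) L

/-- horizontal differential -/
def dh (i : ℕ) : DD F c L (i+1) →ₗ[L] DD F c L i :=
  LinearMap.pi fun p => LinearMap.pi fun A =>
    ∑ q, (rho A (Mat F u lam A i p q)) ∘ₗ LinearMap.proj A ∘ₗ LinearMap.proj q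

theorem dh_apply (i : ℕ) (x : DD F c L (i+1)) (p : Fin (F.rk i)) (A : Finset (Fin c)) :
    dh F u lam i x p A = ∑ q, rho A (Mat F u lam A i p q) (x q A) := by
  simp [dh, LinearMap.sum_apply]

/-- conversion to the twisted module -/
theorem dh_act (i : ℕ) (x : DD F c L (i+1)) (p : Fin (F.rk i)) (A : Finset (Fin c)) :
    dh F u lam i x p A =
      ofV (act (VA L c A) (Mat F u lam A i) (fun q => ofV.symm (x q A)) p) := by
  rw [dh_apply, act_apply, map_sum]
  rfl

/-- vertical differential -/
def dv (i : ℕ) : DD F c L i →ₗ[L] DD F c L i :=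
  LinearMap.pi fun p => cubeδ (fun l => sh l (-(B l - F.deg i p))) ∘ₗ LinearMap.proj p

theorem dv_apply (i : ℕ) (x : DD F c L i) (p : Fin (F.rk i)) :
    dv F B i x p = cubeδ (fun l => sh l (-(B l - F.deg i p))) (x p) := rfl

/-- bigraded pieces -/
def GG (F : FreeComplex K n) (c : ℕ) (L : Type) [Field L] (i q : ℕ) : Submodule L (DD F c L i) where
  carrier := {x | ∀ p A, A.card + 1 ≠ q → x p A = 0}
  zero_mem' := fun _ _ _ => rfl
  add_mem' := fun {x y} hx hy p A h => by
    show x p A + y p A = 0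
    rw [hx p A h, hy p A h, add_zero]
  smul_mem' := fun a x hx p A h => by
    show a • x p A = 0
    rw [hx p A h, smul_zero]

theorem mem_GG {i q : ℕ} {x : DD F c L i} : x ∈ GG F c L i q ↔ ∀ p A, A.card + 1 ≠ q → x p A = 0 := Iff.rfl

theorem GG_zero (i : ℕ) : GG F c L i 0 = ⊥ := by
  rw [eq_bot_iff]
  intro x hx
  rw [Submodule.mem_bot]
  funext p A
  exact hx p A (by omega)

theorem dh_dh (i : ℕ) (x : DD F c L (i+1+1)) : dh F u lam i (dh F u lam (i+1) x) = 0 := by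
  funext p A
  rw [dh_act]
  have : (fun q => ofV.symm (dh F u lam (i+1) x q A)) =
      act (VA L c A) (Mat F u lam A (i+1)) (fun q => ofV.symm (x q A)) := by
    funext q
    rw [dh_act, AddEquiv.symm_apply_apply]
  rw [this, ← act_mul, Mat, Mat, map_complex, act_zero]
  rfl

theorem dv_dv (i : ℕ) (x : DD F c L i) : dv F B i (dv F B i x) = 0 := by
  funext p
  rw [dv_apply, dv_apply, cubeδ_sq _ (fun j l h v => sh_comm h _ _ v)]
  rfl

theorem dv_dh (i : ℕ) (x : DD F c L (i+1)) :
    dv F B i (dh F u lam i x) = dh F u lam i (dv F B (i+1) x) := by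
  funext p A
  rw [dv_apply, cubeδ_apply, dh_apply]
  simp_rw [dh_apply, dv_apply, cubeδ_apply, map_sum, Finset.smul_sum]
  rw [Finset.sum_comm]
  refine Finset.sum_congr rfl fun q _ => Finset.sum_congr rfl fun l hl => ?_
  rw [map_zsmul]
  congr 1
  have h1 := QQ.psi_hom u (Finset.notMem_erase l A) lam (F.isHomog i p q) (B l - F.deg (i+1) q) (x q (A.erase l))
  rw [Finset.insert_erase hl] at h1
  rw [Mat, Mat, Matrix.map_apply, Matrix.map_apply, h1]
  congr 2
  ring

theorem dh_mem (i q : ℕ) (x : DD F c L (i+1)) (hx : x ∈ GG F c L (i+1) q) : dh F u lam i x ∈ GG F c L i q := by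
  intro p A hA
  rw [dh_apply]
  exact Finset.sum_eq_zero fun q' _ => by rw [hx q' A hA, map_zero]

theorem dv_mem (i q : ℕ) (x : DD F c L i) (hx : x ∈ GG F c L i q) : dv F B i x ∈ GG F c L i (q+1) := by
  intro p A hA
  rw [dv_apply, cubeδ_apply]
  refine Finset.sum_eq_zero fun l hl => ?_
  rw [hx p _ (by rw [Finset.card_erase_add_one hl]; omega), map_zero, smul_zero]

theorem van_of (i q : ℕ)
    (h : ∀ p, ∀ A : Finset (Fin c), A.card = q → (∃ j ∈ A, 0 ≤ B j - F.deg i p) ∨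
      (∃ j, j ∉ A ∧ B j - F.deg i p ≤ 0)) :
    Van (DD F c L) (dv F B) (GG F c L) i q := by
  intro x hx hδ
  have h1 : ∀ p, ∃ v : Finset (Fin c) → MvPolynomial (Fin c) L, (∀ A, A.card + 1 ≠ q → v A = 0) ∧
      cubeδ (fun l => sh l (-(B l - F.deg i p))) v = x p := by
    intro p
    refine cube_van _ (fun l => sh l (B l - F.deg i p)) (fun j l h v => sh_comm h _ _ v)
      (fun j l h v => sh_comm h _ _ v) q ?_ (x p) (fun A hA => hx p A (by omega)) (congrFun hδ p)
    intro A hA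
    rcases h p A hA with ⟨j, hj, h2⟩ | ⟨j, hj, h2⟩
    · refine Or.inl ⟨j, hj, fun v => ?_⟩
      rw [sh_sh _ _ _ (Or.inr h2), neg_add_cancel, sh_zero]
    · refine Or.inr ⟨j, hj, fun v => ?_⟩
      rw [sh_sh _ _ _ (Or.inl h2), add_neg_cancel, sh_zero]
  choose v hv1 hv2 using h1
  exact ⟨v, fun p A hA => hv1 p A hA, funext hv2⟩

theorem dd_zero (hrk : ∀ i, c < i → F.rk i = 0) (i : ℕ) (hi : c < i) (x : DD F c L i) : x = 0 := by
  funext p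
  exact (Fin.elim0 (hrk i hi ▸ p))

theorem dh_exact (hlam : ∀ l, Function.Injective fun j => lam j l) (hrk : ∀ i, c < i → F.rk i = 0) (r : ℕ)
    (hN : ∀ A j, NullH (fun i => (F.dd i).map (psi u (ZZ A lam))) (ZZ A lam j ^ r))
    (i q : ℕ) (x : DD F c L (i+1)) (hx : x ∈ GG F c L (i+1) q) (h : dh F u lam i x = 0) :
    ∃ y ∈ GG F c L (i+2) q, dh F u lam (i+1) y = x := by
  have h1 : ∀ A : Finset (Fin c), ∃ y : Fin (F.rk (i+2)) → VA L c A, act _ (Mat F u lam A (i+1)) y =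
      fun q => ofV.symm (x q A) := by
    intro A
    have h2 := (acyc hlam hrk (Mat F u lam A) (fun i => map_complex F _ i) r (hN A) c 0 (by simp) ∅
      (by simp) (by simp) 0 (by simp)).1 i (Or.inr (by omega))
    obtain ⟨y, hy⟩ := h2 (fun q => ofV.symm (x q A)) (by
      rw [mem_tup]; intro p
      have : act (VA L c A) (Mat F u lam A i) (fun q => ofV.symm (x q A)) p = 0 := by
        apply ofV.injective
        rw [← dh_act, h]; rfl
      rw [this]; exact zero_mem _)
    refine ⟨y, ?_⟩
    rw [mem_tup] at hy
    funext p
    have h3 : (fun q => ofV.symm (x q A) : _ → VA L c A) p - act (VA L c A) (Mat F u lam A (i+1)) y p ∈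
      (⊥ : Submodule (MvPolynomial (Fin c) L) (VA L c A)) := hy p
    rw [Submodule.mem_bot] at h3
    exact (sub_eq_zero.1 h3).symm
  choose y hy using h1
  refine ⟨fun p A => if A.card + 1 = q then ofV (y A p) else 0, fun p A hA => if_neg hA, ?_⟩
  funext p A
  by_cases hA : A.card + 1 = q
  · rw [dh_act]
    simp only [hA, if_true, AddEquiv.symm_apply_apply]
    rw [hy A]; simp
  · rw [hx p A hA]
    exact dh_mem F u lam (i+1) q _ (fun p A hA => if_neg hA) p A hA

theorem dh_surj (hlam : ∀ l, Function.Injective fun j => lam j l) (hrk : ∀ i, c < i → F.rk i = 0) (r : ℕ)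
    (hN : ∀ A j, NullH (fun i => (F.dd i).map (psi u (ZZ A lam))) (ZZ A lam j ^ r))
    (q : ℕ) (hq : 2 ≤ q) (x : DD F c L 0) (hx : x ∈ GG F c L 0 q) :
    ∃ y ∈ GG F c L 1 q, dh F u lam 0 y = x := by
  have h1 : ∀ A : Finset (Fin c), A.Nonempty → ∃ y : Fin (F.rk 1) → VA L c A, act _ (Mat F u lam A 0) y =
      fun q => ofV.symm (x q A) := by
    intro A hAn
    have h2 := (acyc hlam hrk (Mat F u lam A) (fun i => map_complex F _ i) r (hN A) c 0 (by simp) ∅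
      (by simp) (by simp) 0 (by simp)).2 hAn
    obtain ⟨y, hy⟩ := h2 (fun q => ofV.symm (x q A)) (by
      rw [mem_tup]; intro p; exact p.elim0)
    refine ⟨y, ?_⟩
    rw [mem_tup] at hy
    funext p
    have h3 : (fun q => ofV.symm (x q A) : _ → VA L c A) p - act (VA L c A) (Mat F u lam A 0) y p ∈
      (⊥ : Submodule (MvPolynomial (Fin c) L) (VA L c A)) := hy p
    rw [Submodule.mem_bot] at h3
    exact (sub_eq_zero.1 h3).symm
  have h1' : ∀ A : Finset (Fin c), ∃ y : Fin (F.rk 1) → VA L c A, A.Nonempty → act _ (Mat F u lam A 0) y =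
      fun q => ofV.symm (x q A) := by
    intro A
    by_cases hA : A.Nonempty
    · obtain ⟨y, hy⟩ := h1 A hA; exact ⟨y, fun _ => hy⟩
    · exact ⟨0, fun h => (hA h).elim⟩
  choose y hy using h1'
  refine ⟨fun p A => if A.card + 1 = q then ofV (y A p) else 0, fun p A hA => if_neg hA, ?_⟩
  funext p A
  by_cases hA : A.card + 1 = q
  · rw [dh_act]
    simp only [hA, if_true, AddEquiv.symm_apply_apply]
    rw [hy A (Finset.card_pos.1 (by omega))]; simp
  · rw [hx p A hA]
    exact dh_mem F u lam 0 q _ (fun p A hA => if_neg hA) p A hA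

end dbl
end MC

namespace MC

/-! ### The first row of the double complex -/

section row
variable (F : FreeComplex K n) {c : ℕ} {L : Type} [Field L] [Algebra K L] (u : Fin n × Fin c → L)
  (lam : Fin c → Fin c → L) (B : Fin c → ℤ)

/-- embedding of the first row -/
def emb (i : ℕ) (v : Fin (F.rk i) → MvPolynomial (Fin c) L) : DD F c L i :=
  fun p A => if A = ∅ then v p else 0

/-- differential of the first row -/
def pd (i : ℕ) : (Fin (F.rk (i+1)) → MvPolynomial (Fin c) L) →ₗ[L] (Fin (F.rk i) → MvPolynomial (Fin c) L) :=
  LinearMap.pi fun p => ∑ q, (rho ∅ (Mat F u lam ∅ i p q)) ∘ₗ LinearMap.proj q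

theorem pd_apply (i : ℕ) (v) (p : Fin (F.rk i)) :
    pd F u lam i v p = ∑ q, rho ∅ (Mat F u lam ∅ i p q) (v q) := by
  simp [pd, LinearMap.sum_apply]

theorem dh_emb (i : ℕ) (v) : dh F u lam i (emb F (i+1) v) = emb F i (pd F u lam i v) := by
  funext p A
  rw [dh_apply, emb]
  by_cases h : A = ∅
  · subst h; simp [emb, pd_apply]
  · simp [emb, h]

theorem emb_mem (i : ℕ) (v : Fin (F.rk i) → MvPolynomial (Fin c) L) : emb F i v ∈ GG F c L i 1 := by
  intro p A hA
  refine if_neg ?_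
  rintro rfl
  simp at hA

theorem eq_emb (i : ℕ) (x : DD F c L i) (hx : x ∈ GG F c L i 1) : x = emb F i (fun p => x p ∅) := by
  funext p A
  by_cases h : A = ∅
  · subst h; simp [emb]
  · rw [emb, if_neg h]
    exact hx p A (by simpa using h)

theorem emb_inj (i : ℕ) {v w : Fin (F.rk i) → MvPolynomial (Fin c) L} (h : emb F i v = emb F i w) : v = w := by
  funext p
  have := congrFun (congrFun h p) ∅
  simpa [emb] using this

theorem emb_sub (i : ℕ) (v w : Fin (F.rk i) → MvPolynomial (Fin c) L) :
    emb F i (v - w) = emb F i v - emb F i w := by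
  funext p A
  by_cases h : A = ∅ <;> simp [emb, h]

/-- the truncated pieces -/
def EE (L : Type) [Field L] (i : ℕ) : Submodule L (Fin (F.rk i) → MvPolynomial (Fin c) L) :=
  Submodule.pi Set.univ fun p => Box (fun l => B l - F.deg i p)

theorem mem_EE (i : ℕ) (v : Fin (F.rk i) → MvPolynomial (Fin c) L) :
    v ∈ EE F B L i ↔ ∀ p l, sh l (-(B l - F.deg i p)) (v p) = 0 := by
  simp only [EE, Submodule.mem_pi, Set.mem_univ, true_implies, mem_Box]

theorem dv_emb (i : ℕ) (v : Fin (F.rk i) → MvPolynomial (Fin c) L) :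
    dv F B i (emb F i v) = 0 ↔ v ∈ EE F B L i := by
  rw [mem_EE]
  constructor
  · intro h p l
    have h1 := congrFun (congrFun h p) {l}
    rw [dv_apply, cubeδ_apply, Finset.sum_singleton] at h1
    simp only [emb, Finset.erase_singleton, if_true, Pi.zero_apply] at h1
    have h2 : sg l {l} * sg l {l} = 1 := by
      unfold sg
      rw [← mul_pow]; norm_num
    calc _ = (sg l {l} * sg l {l}) • sh l (-(B l - F.deg i p)) (v p) := by rw [h2, one_smul]
      _ = 0 := by rw [mul_smul, h1, smul_zero]
  · intro h
    funext p A
    rw [dv_apply, cubeδ_apply]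
    refine Finset.sum_eq_zero fun l _ => ?_
    simp only [emb]
    split_ifs with h1
    · rw [h, smul_zero]
    · rw [map_zero, smul_zero]

theorem pd_EE (i : ℕ) (v) (hv : v ∈ EE F B L (i+1)) : pd F u lam i v ∈ EE F B L i := by
  rw [← dv_emb] at hv ⊢
  rw [← dh_emb, dv_dh, hv, map_zero]

variable {lam}

theorem row_upper
    (hlam : ∀ l, Function.Injective fun j => lam j l) (hrk : ∀ i, c < i → F.rk i = 0) (r : ℕ)
    (hN : ∀ A j, NullH (fun i => (F.dd i).map (psi u (ZZ A lam))) (ZZ A lam j ^ r))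
    (i : ℕ) (hV : ∀ s, Van (DD F c L) (dv F B) (GG F c L) (i+1+s) (1+s)) (w)
    (hy : ∃ y ∈ GG F c L (i+1) 2, dh F u lam i y = dv F B i (emb F i w)) :
    ∃ v, w - pd F u lam i v ∈ EE F B L i := by
  obtain ⟨v, hv, h⟩ := chase_upper (DD F c L) (dh F u lam) (dv F B) (GG F c L) c (dh_dh F u lam)
    (dv_dv F B) (dv_dh F u lam B) (dh_mem F u lam) (dv_mem F B) (dh_exact F u lam hlam hrk r hN)
    (dd_zero F hrk) i hV (emb F i w) hy
  refine ⟨fun p => v p ∅, ?_⟩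
  rw [← dv_emb, emb_sub, ← dh_emb, ← eq_emb F _ v hv]
  exact h

theorem row_surj
    (hlam : ∀ l, Function.Injective fun j => lam j l) (hrk : ∀ i, c < i → F.rk i = 0) (r : ℕ)
    (hN : ∀ A j, NullH (fun i => (F.dd i).map (psi u (ZZ A lam))) (ZZ A lam j ^ r))
    (hV : ∀ s, Van (DD F c L) (dv F B) (GG F c L) (1+s) (1+s)) (w) :
    ∃ v, w - pd F u lam 0 v ∈ EE F B L 0 := by
  refine row_upper F u B hlam hrk r hN 0 (fun s => by rw [Nat.zero_add]; exact hV s) w ?_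
  exact dh_surj F u lam hlam hrk r hN 2 le_rfl _ (dv_mem F B 0 1 _ (emb_mem F 0 w))

theorem row_inj
    (hlam : ∀ l, Function.Injective fun j => lam j l) (hrk : ∀ i, c < i → F.rk i = 0) (r : ℕ)
    (hN : ∀ A j, NullH (fun i => (F.dd i).map (psi u (ZZ A lam))) (ZZ A lam j ^ r))
    (hV : ∀ s, Van (DD F c L) (dv F B) (GG F c L) (1+s) s) (z)
    (h : pd F u lam 0 z ∈ EE F B L 0) : pd F u lam 0 z = 0 := by
  have h1 := chase_lower (DD F c L) (dh F u lam) (dv F B) (GG F c L) c (dh_dh F u lam)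
    (dv_dv F B) (dv_dh F u lam B) (dh_mem F u lam) (dv_mem F B) (dh_exact F u lam hlam hrk r hN)
    (dd_zero F hrk) (GG_zero F) hV (emb F 1 z) (emb_mem F 1 z) (by
      rw [dh_emb]; exact (dv_emb F B 0 _).2 h)
  rw [dh_emb] at h1
  apply emb_inj F 0
  rw [h1]
  funext p A
  simp [emb]

theorem row_lift
    (hlam : ∀ l, Function.Injective fun j => lam j l) (hrk : ∀ i, c < i → F.rk i = 0) (r : ℕ)
    (hN : ∀ A j, NullH (fun i => (F.dd i).map (psi u (ZZ A lam))) (ZZ A lam j ^ r))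
    (hV : ∀ i q, Van (DD F c L) (dv F B) (GG F c L) i (q+1)) (i : ℕ) (z)
    (h : pd F u lam i z ∈ EE F B L i) : ∃ z' ∈ EE F B L (i+1), pd F u lam i z' = pd F u lam i z := by
  obtain ⟨w, hw⟩ := row_upper F u B hlam hrk r hN (i+1) (fun s => by rw [add_comm 1 s]; exact hV _ _) z (by
    refine dh_exact F u lam hlam hrk r hN i 2 _ (dv_mem F B (i+1) 1 _ (emb_mem F _ z)) ?_
    rw [← dv_dh, dh_emb]
    exact (dv_emb F B i _).2 h)
  refine ⟨_, hw, ?_⟩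
  rw [map_sub, sub_eq_self]
  apply emb_inj F i
  rw [← dh_emb, ← dh_emb, dh_dh]
  funext p A
  simp [emb]

theorem row_exact
    (hlam : ∀ l, Function.Injective fun j => lam j l) (hrk : ∀ i, c < i → F.rk i = 0) (r : ℕ)
    (hN : ∀ A j, NullH (fun i => (F.dd i).map (psi u (ZZ A lam))) (ZZ A lam j ^ r))
    (hV : ∀ i q, Van (DD F c L) (dv F B) (GG F c L) i (q+1)) (i : ℕ) (v)
    (hv : v ∈ EE F B L (i+1)) (h : pd F u lam i v = 0) :
    ∃ w ∈ EE F B L (i+2), pd F u lam (i+1) w = v := by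
  obtain ⟨y, hy, h1⟩ := dh_exact F u lam hlam hrk r hN i 1 (emb F (i+1) v) (emb_mem F _ v) (by
    rw [dh_emb, h]; funext p A; simp [emb])
  rw [eq_emb F _ y hy, dh_emb] at h1
  have h2 := emb_inj F _ h1
  obtain ⟨z, hz, h3⟩ := row_lift F u B hlam hrk r hN hV (i+1) (fun p => y p ∅) (by rw [h2]; exact hv)
  exact ⟨z, hz, h3.trans h2⟩

/-- `EE` as a product -/
def EEequiv (F : FreeComplex K n) (B : Fin c → ℤ) (L : Type) [Field L] (i : ℕ) :
    EE F B L i ≃ₗ[L] (∀ p : Fin (F.rk i), (Box (fun l => B l - F.deg i p) : Submodule L (MvPolynomial (Fin c) L))) where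
  toFun v p := ⟨v.1 p, by
    have := v.2
    simp only [EE, Submodule.mem_pi, Set.mem_univ, true_implies] at this
    exact this p⟩
  invFun w := ⟨fun p => (w p).1, by
    simp only [EE, Submodule.mem_pi, Set.mem_univ, true_implies]
    exact fun p => (w p).2⟩
  map_add' _ _ := rfl
  map_smul' _ _ := rfl
  left_inv _ := rfl
  right_inv _ := rfl

theorem fin_Box (k : Type) [Field k] (b : Fin c → ℤ) (hb : ∀ l, 0 ≤ b l) :
    FiniteDimensional k (Box b : Submodule k (MvPolynomial (Fin c) k)) ∧
    (finrank k (Box b : Submodule k (MvPolynomial (Fin c) k)) : ℚ) = ∏ l, (b l : ℚ) := by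
  have e : b = fun l => ((b l).toNat : ℤ) := by funext l; have := hb l; omega
  constructor
  · rw [e]; exact finite_Box _
  · have h := finrank_Box (k := k) (fun l => (b l).toNat)
    rw [← e] at h
    rw [h, Nat.cast_prod]
    refine Finset.prod_congr rfl fun l _ => ?_
    have : (((b l).toNat : ℤ) : ℚ) = (b l : ℚ) := by rw [Int.toNat_of_nonneg (hb l)]
    exact_mod_cast this

theorem fin_EE (F : FreeComplex K n) (B : Fin c → ℤ) (L : Type) [Field L] (i : ℕ) (hB : ∀ l p, F.deg i p ≤ B l) :
    FiniteDimensional L (EE F B L i) ∧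
    (finrank L (EE F B L i) : ℚ) = ∑ p, ∏ l, ((B l : ℚ) - F.deg i p) := by
  have hb := fun p => fin_Box L (fun l => B l - F.deg i p) (fun l => by have := hB l p; omega)
  haveI := fun p => (hb p).1
  constructor
  · exact Module.Finite.equiv (EEequiv F B L i).symm
  · rw [(EEequiv F B L i).finrank_eq, Module.finrank_pi_fintype, Nat.cast_sum]
    refine Finset.sum_congr rfl fun p _ => ?_
    rw [(hb p).2]
    push_cast
    rfl

/-- the map from the truncated piece to the cokernel -/
def toQ (i : ℕ) (lam : Fin c → Fin c → L) : EE F B L i →ₗ[L]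
    ((Fin (F.rk i) → MvPolynomial (Fin c) L) ⧸ LinearMap.range (pd F u lam i)) :=
  (LinearMap.range (pd F u lam i)).mkQ ∘ₗ (EE F B L i).subtype

theorem toQ_surj (h : ∀ w, ∃ v, w - pd F u lam 0 v ∈ EE F B L 0) : Function.Surjective (toQ F u B 0 lam) := by
  intro x
  obtain ⟨w, rfl⟩ := Submodule.mkQ_surjective _ x
  obtain ⟨v, hv⟩ := h w
  refine ⟨⟨_, hv⟩, ?_⟩
  show Submodule.mkQ _ (w - pd F u lam 0 v) = _
  rw [map_sub, sub_eq_self, Submodule.mkQ_apply, Submodule.Quotient.mk_eq_zero]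
  exact ⟨v, rfl⟩

theorem toQ_inj (h : ∀ z, pd F u lam 0 z ∈ EE F B L 0 → pd F u lam 0 z = 0) :
    Function.Injective (toQ F u B 0 lam) := by
  rw [injective_iff_map_eq_zero]
  rintro ⟨x, hx⟩ h1
  have h2 : Submodule.mkQ (LinearMap.range (pd F u lam 0)) x = 0 := h1
  rw [Submodule.mkQ_apply, Submodule.Quotient.mk_eq_zero] at h2
  obtain ⟨z, rfl⟩ := h2
  exact Subtype.ext (h z hx)

theorem finrank_Q
    (hlam : ∀ l, Function.Injective fun j => lam j l) (hrk : ∀ i, c < i → F.rk i = 0) (r : ℕ)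
    (hN : ∀ A j, NullH (fun i => (F.dd i).map (psi u (ZZ A lam))) (ZZ A lam j ^ r))
    (hcn : c ≤ n) (hpd : polyDim (hilbPoly F) = n - c) :
    FiniteDimensional L ((Fin (F.rk 0) → MvPolynomial (Fin c) L) ⧸ LinearMap.range (pd F u lam 0)) ∧
    (finrank L ((Fin (F.rk 0) → MvPolynomial (Fin c) L) ⧸ LinearMap.range (pd F u lam 0)) : ℚ) =
      c.factorial * multQ F c := by
  obtain ⟨D, hD⟩ := deg_bound F
  let B : Fin c → ℤ := fun _ => D
  have hV : ∀ i q, Van (DD F c L) (dv F B) (GG F c L) i (q+1) := by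
    intro i q
    refine van_of F B i (q+1) fun p A hA => Or.inl ?_
    obtain ⟨j, hj⟩ := Finset.card_pos.1 (show 0 < A.card by omega)
    exact ⟨j, hj, by have := hD i p; show 0 ≤ D - _; omega⟩
  have hE := fun i => fin_EE F B L i (fun _ p => hD i p)
  haveI := fun i => (hE i).1
  have hs := toQ_surj F u B (row_surj F u B hlam hrk r hN (fun s => by
    have := hV (1+s) s
    rwa [add_comm s 1] at this))
  haveI hfin : FiniteDimensional L ((Fin (F.rk 0) → MvPolynomial (Fin c) L) ⧸ LinearMap.range (pd F u lam 0)) :=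
    Module.Finite.of_surjective _ hs
  refine ⟨hfin, ?_⟩
  let d : ∀ i, EE F B L (i+1) →ₗ[L] EE F B L i := fun i =>
    (pd F u lam i).restrict (fun v hv => pd_EE F u lam B i v hv)
  have hex : ∀ i, LinearMap.ker (d i) = LinearMap.range (d (i+1)) := by
    intro i
    ext ⟨v, hv⟩
    rw [LinearMap.mem_ker, LinearMap.mem_range]
    constructor
    · intro h
      obtain ⟨w, hw, h1⟩ := row_exact F u B hlam hrk r hN hV i v hv (congrArg Subtype.val h)
      exact ⟨⟨w, hw⟩, Subtype.ext h1⟩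
    · rintro ⟨⟨w, hw⟩, h⟩
      have h1 : pd F u lam (i+1) w = v := congrArg Subtype.val h
      apply Subtype.ext
      show pd F u lam i v = 0
      rw [← h1]
      apply emb_inj F i
      rw [← dh_emb, ← dh_emb, dh_dh]
      funext p A
      simp [emb]
  have h0 := euler_char (fun i => EE F B L i) d hex F.len (fun i hi => by
    have h1 := (hE i).2
    have h2 : ∑ p, ∏ l, ((B l : ℚ) - F.deg i p) = 0 :=
      Finset.sum_eq_zero fun p _ => Fin.elim0 (F.rk_eq_zero i hi ▸ p)
    rw [h2] at h1
    exact_mod_cast h1)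
  rw [← hk_mult F c hcn hpd D]
  have h1 : ∑ i ∈ Finset.range (F.len + 1), (-1 : ℚ) ^ i * (finrank L (EE F B L i) : ℚ) =
      ∑ i ∈ Finset.range (F.len + 1), (-1 : ℚ) ^ i * ∑ p : Fin (F.rk i), ((D : ℚ) - F.deg i p) ^ c := by
    refine Finset.sum_congr rfl fun i _ => ?_
    rw [(hE i).2]
    congr 1
    refine Finset.sum_congr rfl fun p _ => ?_
    show ∏ l : Fin c, ((D : ℚ) - F.deg i p) = _
    rw [Finset.prod_const, Finset.card_univ, Fintype.card_fin]
  rw [← h1, ← h0]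
  have hk : LinearMap.ker (toQ F u B 0 lam) = LinearMap.range (d 0) := by
    ext ⟨v, hv⟩
    rw [LinearMap.mem_ker, LinearMap.mem_range]
    constructor
    · intro h
      have h2 : Submodule.mkQ (LinearMap.range (pd F u lam 0)) v = 0 := h
      rw [Submodule.mkQ_apply, Submodule.Quotient.mk_eq_zero] at h2
      obtain ⟨z, rfl⟩ := h2
      obtain ⟨z', hz', h3⟩ := row_lift F u B hlam hrk r hN hV 0 z hv
      exact ⟨⟨z', hz'⟩, Subtype.ext h3⟩
    · rintro ⟨⟨w, hw⟩, h⟩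
      have h1 : pd F u lam 0 w = v := congrArg Subtype.val h
      show Submodule.mkQ (LinearMap.range (pd F u lam 0)) v = 0
      rw [Submodule.mkQ_apply, Submodule.Quotient.mk_eq_zero]
      exact ⟨w, h1⟩
  have h2 := LinearMap.finrank_range_add_finrank_ker (toQ F u B 0 lam)
  rw [LinearMap.range_eq_top.2 hs, finrank_top, hk] at h2
  have h3 : (finrank L ((Fin (F.rk 0) → MvPolynomial (Fin c) L) ⧸ LinearMap.range (pd F u lam 0)) : ℚ) +
    finrank L (LinearMap.range (d 0)) = finrank L (EE F B L 0) := by exact_mod_cast h2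
  linarith

end row
end MC

namespace MC

theorem betti_ne (F : FreeComplex K n) (i : ℕ) (j : ℤ) : bettiNum F i j ≠ 0 ↔ ∃ p, F.deg i p = j := by
  rw [bettiNum, Finset.card_ne_zero]
  constructor
  · rintro ⟨p, hp⟩
    exact ⟨p, (Finset.mem_filter.1 hp).2⟩
  · rintro ⟨p, hp⟩
    exact ⟨p, Finset.mem_filter.2 ⟨Finset.mem_univ _, hp⟩⟩

theorem prod_Icc (c : ℕ) (f : ℕ → ℤ) : ∏ i ∈ Finset.Icc 1 c, (f i : ℚ) = ∏ l : Fin c, (f (l + 1) : ℚ) := by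
  rw [Fin.prod_univ_eq_prod_range (fun l => (f (l+1) : ℚ)) c]
  have h : Finset.Icc 1 c = Finset.Ico 1 (c+1) := by ext x; simp
  rw [h, Finset.prod_Ico_eq_prod_range]
  simp [add_comm]

theorem chain_le (c : ℕ) (f : ℕ → ℤ) (h : ∀ i, 1 ≤ i → i < c → f i ≤ f (i+1)) :
    ∀ i j, 1 ≤ i → i ≤ j → j ≤ c → f i ≤ f j := by
  intro i j hi hij
  induction j, hij using Nat.le_induction with
  | base => intro _; exact le_rfl
  | succ j hj ih => intro hc; exact (ih (by omega)).trans (h j (by omega) (by omega))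

end MC

/-- **Huneke–Srinivasan Multiplicity Conjecture.**
If `M = S/I` is a graded Cohen-Macaulay algebra of codimension `c` over
`S = K[x_1, …, x_n]` (here `M = coker (F₁ → F₀)` is cyclic, generated in degree
`0`, with minimal free resolution `F`), then
`(1/c!) ∏_{i=1}^c min{j : β_{i,j}(M) ≠ 0} ≤ e(M) ≤ (1/c!) ∏_{i=1}^c max{j : β_{i,j}(M) ≠ 0}`. -/
theorem multiplicity_conjecture (K : Type) [Field K] (n c : ℕ)
    (F : FreeComplex K n)
    (hcyc : F.rk 0 = 1) (hdeg0 : ∀ p : Fin (F.rk 0), F.deg 0 p = 0)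
    (hCM : IsCMcodim F c)
    (mn mx : ℕ → ℤ)
    (hmn : ∀ i ∈ Finset.Icc 1 c, IsLeast {j : ℤ | bettiNum F i j ≠ 0} (mn i))
    (hmx : ∀ i ∈ Finset.Icc 1 c, IsGreatest {j : ℤ | bettiNum F i j ≠ 0} (mx i)) :
    (∏ i ∈ Finset.Icc 1 c, (mn i : ℚ)) / c.factorial ≤ multQ F c ∧
      multQ F c ≤ (∏ i ∈ Finset.Icc 1 c, (mx i : ℚ)) / c.factorial := by
  open MC in
  obtain ⟨hF, hmin, hrk, hc, hpd⟩ := hCM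
  have hcn := c_le_n F hF hmin c hrk hc
  obtain ⟨L, _, _, hcl, u, hu⟩ := generic_exists K n c
  haveI : Infinite L := IsAlgClosed.instInfinite
  obtain ⟨lam, hlam⟩ := exists_lam L c
  obtain ⟨r, hr⟩ := nullst F hF hcyc hdeg0 c hcn hpd u hu
  have hN : ∀ A j, NullH (fun i => (F.dd i).map (psi u (ZZ A lam))) (ZZ A lam j ^ r) := fun A j => hr _ j
  -- degrees
  have hmnle : ∀ i, 1 ≤ i → i ≤ c → ∀ p, mn i ≤ F.deg i p := fun i h1 h2 p =>
    (hmn i (Finset.mem_Icc.2 ⟨h1, h2⟩)).2 ((betti_ne F i _).2 ⟨p, rfl⟩)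
  have hlemx : ∀ i, 1 ≤ i → i ≤ c → ∀ p, F.deg i p ≤ mx i := fun i h1 h2 p =>
    (hmx i (Finset.mem_Icc.2 ⟨h1, h2⟩)).2 ((betti_ne F i _).2 ⟨p, rfl⟩)
  have hmnex : ∀ i, 1 ≤ i → i ≤ c → ∃ p, F.deg i p = mn i := fun i h1 h2 =>
    (betti_ne F i _).1 (hmn i (Finset.mem_Icc.2 ⟨h1, h2⟩)).1
  have hmxex : ∀ i, 1 ≤ i → i ≤ c → ∃ p, F.deg i p = mx i := fun i h1 h2 =>
    (betti_ne F i _).1 (hmx i (Finset.mem_Icc.2 ⟨h1, h2⟩)).1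
  have hmnmono := chain_le c mn (fun i h1 h2 => by
    obtain ⟨q, hq⟩ := hmnex (i+1) (by omega) (by omega)
    obtain ⟨p, hp⟩ := col_ne F hF hmin i q
    have h3 := deg_lt F hmin i p q hp
    have h4 := hmnle i h1 h2.le p
    omega)
  have hmxmono := chain_le c mx (fun i h1 h2 => by
    obtain ⟨p, hp⟩ := hmxex i h1 (by omega)
    obtain ⟨i, rfl⟩ : ∃ k, i = k + 1 := ⟨i - 1, by omega⟩
    obtain ⟨q, hq⟩ := row_ne F hmin c u hlam r (hN ∅) i h2 p
    have h3 := deg_lt F hmin (i+1) p q hq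
    have h4 := hlemx (i+1+1) (by omega) (by omega) q
    omega)
  have hmnpos : ∀ i, 1 ≤ i → i ≤ c → 0 ≤ mn i := by
    intro i h1 h2
    refine le_trans ?_ (hmnmono 1 i le_rfl h1 h2)
    obtain ⟨q, hq⟩ := hmnex 1 (by omega) (by omega)
    obtain ⟨p, hp⟩ := col_ne F hF hmin 0 q
    have h3 : F.deg 0 p < F.deg 1 q := deg_lt F hmin 0 p q hp
    have h4 := hdeg0 p
    rw [← hq]
    omega
  have hmxpos : ∀ i, 1 ≤ i → i ≤ c → 0 ≤ mx i := by
    intro i h1 h2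
    obtain ⟨q, hq⟩ := hmnex i h1 h2
    have := hlemx i h1 h2 q
    have := hmnpos i h1 h2
    omega
  -- dimension of the first piece
  have hE0 : ∀ B : Fin c → ℤ, (∀ l, 0 ≤ B l) → FiniteDimensional L (EE F B L 0) ∧
      (finrank L (EE F B L 0) : ℚ) = ∏ l, (B l : ℚ) := by
    intro B hB
    have h := fin_EE F B L 0 (fun l p => by rw [hdeg0]; exact hB l)
    refine ⟨h.1, ?_⟩
    rw [h.2]
    have h1 : ∀ p : Fin (F.rk 0), ∏ l, ((B l : ℚ) - F.deg 0 p) = ∏ l, (B l : ℚ) := by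
      intro p
      refine Finset.prod_congr rfl fun l _ => ?_
      rw [hdeg0]; simp
    rw [Finset.sum_congr rfl (fun p _ => h1 p), Finset.sum_const, Finset.card_univ, Fintype.card_fin, hcyc,
      one_smul]
  obtain ⟨hQf, hQ⟩ := finrank_Q F u hlam hrk r hN hcn hpd
  have hfac : (0 : ℚ) < c.factorial := by exact_mod_cast c.factorial_pos
  rw [prod_Icc, prod_Icc, div_le_iff₀ hfac, le_div_iff₀ hfac, mul_comm (multQ F c), ← hQ]
  constructor
  · let B : Fin c → ℤ := fun l => mn (l + 1)
    have hE := hE0 B (fun l => hmnpos _ (by omega) (by omega))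
    haveI := hE.1
    have hi := toQ_inj F u B (row_inj F u B hlam hrk r hN (fun s => by
      refine van_of F B (1+s) s fun p A hA => Or.inr ?_
      have hsc : 1 + s ≤ c := by
        by_contra hlt
        exact Fin.elim0 (hrk (1+s) (by omega) ▸ p)
      obtain ⟨l, hl, hlA⟩ : ∃ l : Fin c, (l : ℕ) ≤ s ∧ l ∉ A := by
        by_contra hcon
        push Not at hcon
        have h1 : (Finset.univ : Finset (Fin (s+1))).card ≤ A.card :=
          Finset.card_le_card_of_injOn (fun x => (⟨x, by omega⟩ : Fin c))
            (fun x _ => hcon _ (by show (x : ℕ) ≤ s; omega))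
            (fun x _ y _ h => by
              have := congrArg Fin.val h
              exact Fin.ext this)
        rw [Finset.card_univ, Fintype.card_fin] at h1
        omega
      refine ⟨l, hlA, ?_⟩
      have h1 := hmnmono (l+1) (1+s) (by omega) (by omega) hsc
      have h2 := hmnle (1+s) (by omega) hsc p
      show mn (l+1) - _ ≤ 0
      omega))
    have h1 := LinearMap.finrank_le_finrank_of_injective hi
    show ∏ l, (B l : ℚ) ≤ _
    rw [← hE.2]
    exact_mod_cast h1
  · let B : Fin c → ℤ := fun l => mx (l + 1)
    have hE := hE0 B (fun l => hmxpos _ (by omega) (by omega))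
    haveI := hE.1
    have hi := toQ_surj F u B (row_surj F u B hlam hrk r hN (fun s => by
      refine van_of F B (1+s) (1+s) fun p A hA => Or.inl ?_
      have hsc : 1 + s ≤ c := by
        by_contra hlt
        exact Fin.elim0 (hrk (1+s) (by omega) ▸ p)
      obtain ⟨l, hlA, hl⟩ : ∃ l ∈ A, s ≤ (l : ℕ) := by
        by_contra hcon
        push Not at hcon
        have h1 : A.card ≤ (Finset.range s).card :=
          Finset.card_le_card_of_injOn (fun x => (x : ℕ)) (fun x hx => by simpa using hcon x hx)
            (fun x _ y _ h => Fin.ext h)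
        rw [Finset.card_range] at h1
        omega
      refine ⟨l, hlA, ?_⟩
      have h1 := hmxmono (1+s) (l+1) (by omega) (by omega) (by omega)
      have h2 := hlemx (1+s) (by omega) hsc p
      show 0 ≤ mx (l+1) - _
      omega))
    have h1 := LinearMap.finrank_le_finrank_of_surjective hi
    show _ ≤ ∏ l, (B l : ℚ)
    rw [← hE.2]
    exact_mod_cast h1

end
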